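/- Let m be a positive integer with m ∉ {1, 2, 3, 4, 6}, let z = ℝ² with its standard inner product, and let W_m be the real vector space of all linear maps from z to so(m). Set d = m(m−1)/2 − ⌊m/2⌋(⌊m/2⌋ + 2); then d > 1. There exists a nonzero polynomial function P on W_m such that every j ∈ W_m with P(j) ≠ 0 belongs to a d-parameter family of isospectral, pairwise inequivalent elements of W_m: there is a continuous injective map F from the open unit ball of ℝ^d into W_m with F(0) = j such that F(t) and F(s) are isospectral for all t, s in the ball, while F(t) and F(s) are not equivalent whenever t ≠ s. -/

import Mathlib

open scoped RealInnerProductSpace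

/-- `W_m`: the real vector space of all linear maps `j` from `z = ℝ²` to `so(m)`, i.e.
(continuous, as we are in finite dimensions) linear maps `j` from `ℝ²` to the
endomorphisms of `ℝ^m` such that every `j(Z)` is skew-adjoint.  It is realized as a
submodule of the space of operator-valued linear maps. -/
noncomputable def Wso (m : ℕ) : Submodule ℝ (EuclideanSpace ℝ (Fin 2) →L[ℝ]
    (EuclideanSpace ℝ (Fin m) →L[ℝ] EuclideanSpace ℝ (Fin m))) where
  carrier := {j | ∀ (Z : EuclideanSpace ℝ (Fin 2)) (x y : EuclideanSpace ℝ (Fin m)),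
    ⟪j Z x, y⟫ = -⟪x, j Z y⟫}
  add_mem' := by
    intro a b ha hb Z x y
    simp only [ContinuousLinearMap.add_apply, inner_add_left, inner_add_right,
      ha Z x y, hb Z x y]
    ring
  zero_mem' := by
    intro Z x y
    simp
  smul_mem' := by
    intro c a ha Z x y
    simp only [ContinuousLinearMap.coe_smul', Pi.smul_apply, real_inner_smul_left,
      real_inner_smul_right, ha Z x y]
    ring

/-- A polynomial function on `W_m`: an element of the subalgebra of real-valued
functions on `W_m` generated by the linear functionals. -/
def IsPolynomialFun (m : ℕ) (P : Wso m → ℝ) : Prop :=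
  P ∈ Algebra.adjoin ℝ {f : Wso m → ℝ | ∃ φ : Wso m →ₗ[ℝ] ℝ, f = ⇑φ}

/-- `j ∼ j'`: for each `Z` there is an orthogonal map `A_Z` of `ℝ^m` with
`A_Z j(Z) A_Z⁻¹ = j'(Z)`. -/
def IsospectralJ (m : ℕ) (j j' : Wso m) : Prop :=
  ∀ Z : EuclideanSpace ℝ (Fin 2),
    ∃ A : EuclideanSpace ℝ (Fin m) ≃ₗᵢ[ℝ] EuclideanSpace ℝ (Fin m),
      ∀ x : EuclideanSpace ℝ (Fin m), A ((j : EuclideanSpace ℝ (Fin 2) →L[ℝ]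
          (EuclideanSpace ℝ (Fin m) →L[ℝ] EuclideanSpace ℝ (Fin m))) Z (A.symm x))
        = (j' : EuclideanSpace ℝ (Fin 2) →L[ℝ]
          (EuclideanSpace ℝ (Fin m) →L[ℝ] EuclideanSpace ℝ (Fin m))) Z x

/-- `j ≃ j'`: there are orthogonal maps `A` of `ℝ^m` and `C` of `z = ℝ²` with
`A j(Z) A⁻¹ = j'(C Z)` for all `Z`. -/
def EquivalentJ (m : ℕ) (j j' : Wso m) : Prop :=
  ∃ (A : EuclideanSpace ℝ (Fin m) ≃ₗᵢ[ℝ] EuclideanSpace ℝ (Fin m))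
    (C : EuclideanSpace ℝ (Fin 2) ≃ₗᵢ[ℝ] EuclideanSpace ℝ (Fin 2)),
    ∀ (Z : EuclideanSpace ℝ (Fin 2)) (x : EuclideanSpace ℝ (Fin m)),
      A ((j : EuclideanSpace ℝ (Fin 2) →L[ℝ]
          (EuclideanSpace ℝ (Fin m) →L[ℝ] EuclideanSpace ℝ (Fin m))) Z (A.symm x))
        = (j' : EuclideanSpace ℝ (Fin 2) →L[ℝ]
          (EuclideanSpace ℝ (Fin m) →L[ℝ] EuclideanSpace ℝ (Fin m))) (C Z) x

/-- A real-valued function on a real vector space that is a polynomial in linear functionals. -/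
def IsPolyFun {V : Type*} [AddCommGroup V] [Module ℝ V] (f : V → ℝ) : Prop :=
  f ∈ Algebra.adjoin ℝ {f : V → ℝ | ∃ φ : V →ₗ[ℝ] ℝ, f = ⇑φ}

namespace IsPolyFun

section Algebra

variable {V V' : Type*} [AddCommGroup V] [Module ℝ V] [AddCommGroup V'] [Module ℝ V']

theorem linear (φ : V →ₗ[ℝ] ℝ) : IsPolyFun (fun x => φ x) :=
  Algebra.subset_adjoin ⟨φ, rfl⟩

theorem const (c : ℝ) : IsPolyFun (fun _ : V => c) :=
  Subalgebra.algebraMap_mem _ c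

theorem add {f g : V → ℝ} (hf : IsPolyFun f) (hg : IsPolyFun g) : IsPolyFun (fun x => f x + g x) :=
  Subalgebra.add_mem _ hf hg

theorem mul {f g : V → ℝ} (hf : IsPolyFun f) (hg : IsPolyFun g) : IsPolyFun (fun x => f x * g x) :=
  Subalgebra.mul_mem _ hf hg

theorem sub {f g : V → ℝ} (hf : IsPolyFun f) (hg : IsPolyFun g) : IsPolyFun (fun x => f x - g x) :=
  Subalgebra.sub_mem _ hf hg

theorem sum {ι : Type*} (s : Finset ι) {f : ι → V → ℝ} (hf : ∀ i ∈ s, IsPolyFun (f i)) :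
    IsPolyFun (fun x => ∑ i ∈ s, f i x) := by
  have h := Subalgebra.sum_mem _ hf
  have e : (fun x => ∑ i ∈ s, f i x) = ∑ i ∈ s, f i := by ext x; simp
  unfold IsPolyFun; rw [e]; exact h

theorem prod {ι : Type*} (s : Finset ι) {f : ι → V → ℝ} (hf : ∀ i ∈ s, IsPolyFun (f i)) :
    IsPolyFun (fun x => ∏ i ∈ s, f i x) := by
  have h := Subalgebra.prod_mem _ hf
  have e : (fun x => ∏ i ∈ s, f i x) = ∏ i ∈ s, f i := by ext x; simp
  unfold IsPolyFun; rw [e]; exact h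

theorem det {n : Type*} [Fintype n] [DecidableEq n] {M : V → Matrix n n ℝ}
    (hM : ∀ a b, IsPolyFun (fun x => M x a b)) : IsPolyFun (fun x => (M x).det) := by
  simp only [Matrix.det_apply']
  exact sum _ fun σ _ => mul (const _) (prod _ fun i _ => hM _ _)

/-- Induction principle for polynomial functions. -/
theorem induction {p : (f : V → ℝ) → IsPolyFun f → Prop}
    (hlin : ∀ φ : V →ₗ[ℝ] ℝ, p (fun x => φ x) (linear φ))
    (hconst : ∀ c : ℝ, p (fun _ => c) (const c))
    (hadd : ∀ f g (hf : IsPolyFun f) (hg : IsPolyFun g), p f hf → p g hg →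
      p (fun x => f x + g x) (hf.add hg))
    (hmul : ∀ f g (hf : IsPolyFun f) (hg : IsPolyFun g), p f hf → p g hg →
      p (fun x => f x * g x) (hf.mul hg))
    {f : V → ℝ} (hf : IsPolyFun f) : p f hf := by
  refine Algebra.adjoin_induction (p := fun f h => p f h) ?_ hconst hadd hmul hf
  rintro _ ⟨φ, rfl⟩
  exact hlin φ

theorem comp_linear {f : V → ℝ} (hf : IsPolyFun f) (L : V' →ₗ[ℝ] V) :
    IsPolyFun (fun x => f (L x)) := by
  induction hf using IsPolyFun.induction with
  | hlin φ => exact linear (φ ∘ₗ L)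
  | hconst c => exact const c
  | hadd f g _ _ hf hg => exact hf.add hg
  | hmul f g _ _ hf hg => exact hf.mul hg

theorem exists_polynomial_line {f : V → ℝ} (hf : IsPolyFun f) (u v : V) :
    ∃ p : Polynomial ℝ, ∀ t : ℝ, f (u + t • v) = p.eval t := by
  induction hf using IsPolyFun.induction with
  | hlin φ =>
    refine ⟨Polynomial.C (φ u) + Polynomial.X * Polynomial.C (φ v), fun t => ?_⟩
    simp
    ring
  | hconst c => exact ⟨Polynomial.C c, fun t => by simp⟩
  | hadd f g _ _ hf hg =>
    obtain ⟨p, hp⟩ := hf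
    obtain ⟨q, hq⟩ := hg
    exact ⟨p + q, fun t => by simp [hp, hq]⟩
  | hmul f g _ _ hf hg =>
    obtain ⟨p, hp⟩ := hf
    obtain ⟨q, hq⟩ := hg
    exact ⟨p * q, fun t => by simp [hp, hq]⟩

/-- Two polynomial functions, each nonzero somewhere, are nonzero at a common point. -/
theorem exists_mul_ne_zero {f g : V → ℝ} (hf : IsPolyFun f) (hg : IsPolyFun g)
    (hf0 : ∃ x, f x ≠ 0) (hg0 : ∃ x, g x ≠ 0) : ∃ x, f x * g x ≠ 0 := by
  obtain ⟨x, hx⟩ := hf0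
  obtain ⟨y, hy⟩ := hg0
  obtain ⟨p, hp⟩ := hf.exists_polynomial_line x (y - x)
  obtain ⟨q, hq⟩ := hg.exists_polynomial_line x (y - x)
  have hp0 : p ≠ 0 := by
    rintro rfl
    have := hp 0
    simp at this
    exact hx this
  have hq0 : q ≠ 0 := by
    rintro rfl
    have := hq 1
    simp at this
    exact hy this
  by_contra! h
  refine mul_ne_zero hp0 hq0 (Polynomial.funext fun t => ?_)
  rw [Polynomial.eval_mul, ← hp, ← hq, h]
  simp

end Algebra

section Analysis

variable {V : Type*} [NormedAddCommGroup V] [NormedSpace ℝ V] [FiniteDimensional ℝ V]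

theorem contDiff {f : V → ℝ} (hf : IsPolyFun f) : ContDiff ℝ ⊤ f := by
  induction hf using IsPolyFun.induction with
  | hlin φ => exact (LinearMap.toContinuousLinearMap φ).contDiff
  | hconst c => exact contDiff_const
  | hadd f g _ _ hf hg => exact hf.add hg
  | hmul f g _ _ hf hg => exact hf.mul hg

theorem differentiable {f : V → ℝ} (hf : IsPolyFun f) : Differentiable ℝ f :=
  hf.contDiff.differentiable (by simp)

theorem fderiv_apply {f : V → ℝ} (hf : IsPolyFun f) (v : V) :
    IsPolyFun (fun x => fderiv ℝ f x v) := by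
  induction hf using IsPolyFun.induction with
  | hlin φ =>
    have : (fun x => fderiv ℝ (fun x => φ x) x v) = fun _ => φ v := by
      ext x
      exact congrArg (· v) (LinearMap.toContinuousLinearMap φ).fderiv
    rw [this]
    exact const _
  | hconst c => simpa using const 0
  | hadd f g hf' hg' hf hg =>
    have : (fun x => fderiv ℝ (fun x => f x + g x) x v) =
        fun x => fderiv ℝ f x v + fderiv ℝ g x v := by
      ext x
      rw [fderiv_fun_add hf'.differentiable.differentiableAt hg'.differentiable.differentiableAt]
      rfl
    rw [this]
    exact hf.add hg
  | hmul f g hf' hg' hf hg =>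
    have : (fun x => fderiv ℝ (fun x => f x * g x) x v) =
        fun x => f x * fderiv ℝ g x v + g x * fderiv ℝ f x v := by
      ext x
      rw [fderiv_fun_mul hf'.differentiable.differentiableAt hg'.differentiable.differentiableAt]
      rfl
    rw [this]
    exact (hf'.mul hg).add (hg'.mul hf)

end Analysis

end IsPolyFun

section Core

variable {V : Type*} [NormedAddCommGroup V] [NormedSpace ℝ V]

/-- A finite family of linearly independent functionals admits a dual family of vectors. -/
theorem exists_dual_vectors {κ : Type*} [Fintype κ] [DecidableEq κ]
    {g : κ → V →L[ℝ] ℝ} (hg : LinearIndependent ℝ g) :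
    ∃ v : κ → V, (Matrix.of fun a b => g a (v b)) = (1 : Matrix κ κ ℝ) := by
  let T : V →ₗ[ℝ] (κ → ℝ) := LinearMap.pi fun a => (g a : V →ₗ[ℝ] ℝ)
  have hT : Function.Surjective T := by
    rw [← LinearMap.dualMap_injective_iff]
    refine (injective_iff_map_eq_zero _).2 fun θ hθ => ?_
    have h1 : ∑ a, θ (fun j => if a = j then 1 else 0) • g a = 0 := by
      ext x
      have h2 : θ (T x) = 0 := LinearMap.congr_fun hθ x
      rw [LinearMap.pi_apply_eq_sum_univ θ] at h2
      simpa [T, mul_comm] using h2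
    have h3 := Fintype.linearIndependent_iff.1 hg _ h1
    refine LinearMap.ext fun x => ?_
    rw [LinearMap.pi_apply_eq_sum_univ θ]
    simp [h3]
  choose v hv using fun b => hT (Pi.single b 1)
  refine ⟨v, ?_⟩
  ext a b
  have := congrFun (hv b) a
  simpa [T, Matrix.one_apply, Pi.single_apply] using this

theorem linearIndependent_of_det_ne_zero {κ : Type*} [Fintype κ] [DecidableEq κ]
    {g : κ → V →L[ℝ] ℝ} {v : κ → V} (h : (Matrix.of fun a b => g a (v b)).det ≠ 0) :
    LinearIndependent ℝ g := by
  rw [Fintype.linearIndependent_iff]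
  intro c hc
  have : Matrix.vecMul c (Matrix.of fun a b => g a (v b)) = 0 := by
    ext b
    have := congrArg (fun φ : V →L[ℝ] ℝ => φ (v b)) hc
    simpa [Matrix.vecMul, dotProduct] using this
  exact congrFun (Matrix.eq_zero_of_vecMul_eq_zero h this)

/-- A linearly independent family in a space can be enlarged by vectors of a set with large
span. -/
theorem exists_linearIndependent_sumElim {M : Type*} [AddCommGroup M] [Module ℝ M]
    [FiniteDimensional ℝ M] {α : Type*} [Fintype α] {g : α → M} (hg : LinearIndependent ℝ g)
    (s : Set M) {d : ℕ} (hd : Fintype.card α + d ≤ Module.finrank ℝ (Submodule.span ℝ s)) :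
    ∃ h : Fin d → M, (∀ i, h i ∈ s) ∧ LinearIndependent ℝ (Sum.elim g h) := by
  let L := Submodule.span ℝ (Set.range g)
  have hL : Module.finrank ℝ L = Fintype.card α := finrank_span_eq_card hg
  obtain ⟨f, hf, -, hfi⟩ := Submodule.exists_fun_fin_finrank_span_eq ℝ (L.mkQ '' s)
  have hle : d ≤ Module.finrank ℝ (Submodule.span ℝ (L.mkQ '' s)) := by
    rw [← Submodule.map_span]
    have h1 := LinearMap.finrank_range_add_finrank_ker (L.mkQ.domRestrict (Submodule.span ℝ s))
    have h2 : Module.finrank ℝ (L.mkQ.domRestrict (Submodule.span ℝ s)).ker ≤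
        Module.finrank ℝ L := by
      refine LinearMap.finrank_le_finrank_of_injective
        (f := ((Submodule.span ℝ s).subtype ∘ₗ
          (L.mkQ.domRestrict (Submodule.span ℝ s)).ker.subtype).codRestrict L ?_) ?_
      · rintro ⟨x, hx⟩
        simpa using hx
      · intro x y hxy
        have := congrArg Subtype.val hxy
        exact Subtype.ext (Subtype.ext this)
    rw [LinearMap.range_domRestrict] at h1
    omega
  choose h hs hh using hf
  refine ⟨fun i => h (Fin.castLE hle i), fun i => hs _, ?_⟩
  have hq : LinearIndependent ℝ (Submodule.Quotient.mk (p := L) ∘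
      fun i => h (Fin.castLE hle i)) := by
    have e : (Submodule.Quotient.mk (p := L) ∘ fun i => h (Fin.castLE hle i)) =
        f ∘ Fin.castLE hle := funext fun i => hh _
    rw [e]
    exact hfi.comp _ (Fin.castLE_injective hle)
  exact LinearIndependent.sumElim_of_quotient (M' := L)
    (f := fun a => ⟨g a, Submodule.subset_span ⟨a, rfl⟩⟩)
    (LinearIndependent.of_comp L.subtype hg) _ hq

end Core

section LocalFamily

open Topology Filter

variable {V : Type*} [NormedAddCommGroup V] [NormedSpace ℝ V] [FiniteDimensional ℝ V]

/-- A map with polynomial components whose differentials at `j` are linearly independent has a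
continuously differentiable local right inverse through `j`. -/
theorem exists_local_section {κ : Type*} [Fintype κ] [DecidableEq κ] {G : κ → V → ℝ}
    (hG : ∀ a, IsPolyFun (G a)) {v : κ → V} {j : V}
    (hdet : (Matrix.of fun a b => fderiv ℝ (G a) j (v b)).det ≠ 0) :
    ∃ s : (κ → ℝ) → V, s (fun a => G a j) = j ∧ ∀ᶠ y in 𝓝 (fun a => G a j),
      ContDiffAt ℝ 1 s y ∧ ∀ a, G a (s y) = y a := by
  let h : (κ → ℝ) → V := fun c => j + ∑ b, c b • v b
  have hh : ∀ c, HasFDerivAt h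
      (∑ b, (ContinuousLinearMap.proj (R := ℝ) (φ := fun _ : κ => ℝ) b).smulRight (v b)) c := by
    intro c
    refine HasFDerivAt.const_add j (HasFDerivAt.fun_sum fun b _ => ?_)
    exact ((ContinuousLinearMap.proj (R := ℝ) (φ := fun _ : κ => ℝ) b).smulRight (v b)).hasFDerivAt
  have hhc : ContDiff ℝ 1 h :=
    contDiff_const.add (ContDiff.sum fun b _ => (contDiff_apply ℝ ℝ b).smul contDiff_const)
  have h0 : h 0 = j := by simp [h]
  let g : (κ → ℝ) → (κ → ℝ) := fun c a => G a (h c)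
  have hg : ContDiff ℝ 1 g :=
    contDiff_pi.2 fun a => ((hG a).contDiff.of_le le_top).comp hhc
  let M : Matrix κ κ ℝ := Matrix.of fun a b => fderiv ℝ (G a) j (v b)
  have hM : IsUnit M.det := isUnit_iff_ne_zero.2 hdet
  let e : (κ → ℝ) ≃L[ℝ] (κ → ℝ) :=
    (Matrix.toLinearEquiv' M
      ((Matrix.isUnit_iff_isUnit_det M).2 hM).invertible).toContinuousLinearEquiv
  have hge : HasFDerivAt g (e : (κ → ℝ) →L[ℝ] (κ → ℝ)) 0 := by
    rw [hasFDerivAt_pi']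
    intro a
    have h1 : HasFDerivAt (G a) (fderiv ℝ (G a) j) (h 0) := by
      rw [h0]
      exact (hG a).differentiable.differentiableAt.hasFDerivAt
    refine (h1.comp (0 : κ → ℝ) (hh 0)).congr_fderiv (ContinuousLinearMap.ext fun c => ?_)
    simp [e, M, Matrix.toLinearEquiv', Matrix.mulVec, dotProduct, mul_comm]
  have hg0 : g 0 = fun a => G a j := by simp [g, h0]
  have hgc : ContDiffAt ℝ 1 g 0 := hg.contDiffAt
  have hstrict : HasStrictFDerivAt g (e : (κ → ℝ) →L[ℝ] (κ → ℝ)) 0 :=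
    hgc.hasStrictFDerivAt' hge one_ne_zero
  have hσ := hgc.to_localInverse hge one_ne_zero
  refine ⟨fun y => h (hgc.localInverse hge one_ne_zero y), ?_, ?_⟩
  · rw [← hg0]
    have := hstrict.localInverse_apply_image
    change h (hstrict.localInverse g e 0 (g 0)) = j
    rw [this, h0]
  · rw [← hg0]
    filter_upwards [hσ.eventually (by simp), hstrict.eventually_right_inverse] with y h1 h2
    refine ⟨hhc.contDiffAt.comp y h1, fun a => ?_⟩
    exact congrFun h2 a

/-- If the differentials of all `Φ i` depend linearly on those of the subfamily `Φ (e a)` wherever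
the latter are independent, then the joint level sets of `Φ` through a point where the subfamily
together with `ψ` is independent contain a family of points parametrized by the values of `ψ`. -/
theorem exists_level_family {ι α : Type*} [Fintype α] [DecidableEq α] {d : ℕ}
    {Φ : ι → V → ℝ} (hΦ : ∀ i, IsPolyFun (Φ i)) {e : α → ι}
    {ψ : Fin d → V → ℝ} (hψ : ∀ i, IsPolyFun (ψ i))
    (hmax : ∀ x, LinearIndependent ℝ (fun a => fderiv ℝ (Φ (e a)) x) →
      ∀ i, fderiv ℝ (Φ i) x ∈ Submodule.span ℝ (Set.range fun a => fderiv ℝ (Φ (e a)) x))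
    {v : α ⊕ Fin d → V} {j : V}
    (hdet : (Matrix.of fun a b => fderiv ℝ (Sum.elim (Φ ∘ e) ψ a) j (v b)).det ≠ 0)
    {U : Set V} (hU : U ∈ 𝓝 j) :
    ∃ F : Metric.ball (0 : EuclideanSpace ℝ (Fin d)) 1 → V, Continuous F ∧
      F ⟨0, by simp⟩ = j ∧ (∀ t, F t ∈ U) ∧ (∀ i t, Φ i (F t) = Φ i j) ∧
      ∀ t s, t ≠ s → ∃ i, ψ i (F t) ≠ ψ i (F s) := by
  set G : α ⊕ Fin d → V → ℝ := Sum.elim (Φ ∘ e) ψ with hGdef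
  have hG : ∀ a, IsPolyFun (G a) := by
    rintro (a | i)
    · exact hΦ _
    · exact hψ _
  obtain ⟨s, hs0, hs⟩ := exists_local_section hG hdet
  set y0 : α ⊕ Fin d → ℝ := fun a => G a j with hy0
  have hsc : ContinuousAt s y0 := hs.self_of_nhds.1.continuousAt
  have hdetc : IsPolyFun fun x => (Matrix.of fun a b => fderiv ℝ (G a) x (v b)).det :=
    IsPolyFun.det fun a b => (hG a).fderiv_apply (v b)
  have hnear : ∀ᶠ y in 𝓝 y0, s y ∈ U ∧
      (Matrix.of fun a b => fderiv ℝ (G a) (s y) (v b)).det ≠ 0 := by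
    have h1 : ∀ᶠ x in 𝓝 j, x ∈ U ∧ (Matrix.of fun a b => fderiv ℝ (G a) x (v b)).det ≠ 0 :=
      (eventually_mem_set.2 hU).and
        (hdetc.contDiff.continuous.continuousAt.eventually_ne hdet)
    rw [← hs0] at h1
    exact hsc.eventually h1
  let L : EuclideanSpace ℝ (Fin d) → (α ⊕ Fin d → ℝ) := fun t => y0 + Sum.elim (fun _ => 0) t
  have hLd : ContDiff ℝ 1 L := by
    refine contDiff_const.add (contDiff_pi.2 ?_)
    rintro (a | i)
    · exact contDiff_const
    · exact (EuclideanSpace.proj (𝕜 := ℝ) i).contDiff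
  have hL0 : L 0 = y0 := by
    ext (a | i) <;> simp [L]
  have hev := hs.and hnear
  rw [← hL0] at hev
  obtain ⟨ε, hε, hball⟩ :=
    Metric.eventually_nhds_iff_ball.1 (hLd.continuous.continuousAt.eventually hev)
  let B := Metric.ball (0 : EuclideanSpace ℝ (Fin d)) ε
  let f : EuclideanSpace ℝ (Fin d) → V := fun t => s (L t)
  have hf : ∀ t ∈ B, ContDiffAt ℝ 1 f t := fun t ht => (hball t ht).1.1.comp t hLd.contDiffAt
  have hfG : ∀ t ∈ B, ∀ a, G a (f t) = L t a := fun t ht => (hball t ht).1.2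
  have hconst : ∀ i, ∀ t ∈ B, Φ i (f t) = Φ i j := by
    intro i t ht
    have hdiff : ∀ i, ∀ t ∈ B, HasFDerivAt (fun t => Φ i (f t))
        ((fderiv ℝ (Φ i) (f t)).comp (fderiv ℝ f t)) t := fun i t ht =>
      ((hΦ i).differentiable.differentiableAt.hasFDerivAt).comp t
        ((hf t ht).differentiableAt one_ne_zero).hasFDerivAt
    have key : Set.EqOn (fderiv ℝ fun t => Φ i (f t)) 0 B := by
      intro t ht
      rw [(hdiff i t ht).fderiv]
      have hind := linearIndependent_of_det_ne_zero (hball t ht).2.2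
      have hmem := hmax (f t) (hind.comp Sum.inl Sum.inl_injective) i
      refine Submodule.span_induction
        (p := fun φ _ => φ.comp (fderiv ℝ f t) = 0) ?_ ?_ ?_ ?_ hmem
      · rintro _ ⟨a, rfl⟩
        rw [← (hdiff (e a) t ht).fderiv]
        have hloc : (fun t => Φ (e a) (f t)) =ᶠ[𝓝 t] fun _ => y0 (Sum.inl a) := by
          filter_upwards [Metric.isOpen_ball.mem_nhds ht] with u hu
          simpa [L, hGdef] using hfG u hu (Sum.inl a)
        rw [hloc.fderiv_eq]
        simp
      · simp
      · intro φ χ _ _ h1 h2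
        rw [ContinuousLinearMap.add_comp, h1, h2, add_zero]
      · intro c φ _ h1
        rw [ContinuousLinearMap.smul_comp, h1, smul_zero]
    have := Metric.isOpen_ball.is_const_of_fderiv_eq_zero
      (convex_ball (0 : EuclideanSpace ℝ (Fin d)) ε).isPreconnected
      (fun t ht => (hdiff i t ht).differentiableAt.differentiableWithinAt) key ht
      (Metric.mem_ball_self hε)
    simpa [f, hL0, hs0] using this
  have hmem : ∀ t : Metric.ball (0 : EuclideanSpace ℝ (Fin d)) 1,
      ε • (t : EuclideanSpace ℝ (Fin d)) ∈ B := by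
    rintro ⟨t, ht⟩
    rw [mem_ball_zero_iff] at ht
    rw [mem_ball_zero_iff, norm_smul, Real.norm_of_nonneg hε.le]
    nlinarith
  refine ⟨fun t => f (ε • (t : EuclideanSpace ℝ (Fin d))), ?_, ?_, ?_, ?_, ?_⟩
  · rw [continuous_iff_continuousAt]
    intro t
    exact ContinuousAt.comp (f := fun t : Metric.ball (0 : EuclideanSpace ℝ (Fin d)) 1 =>
      ε • (t : EuclideanSpace ℝ (Fin d))) (hf _ (hmem t)).continuousAt
      (by fun_prop)
  · simp [f, hL0, hs0]
  · exact fun t => (hball _ (hmem t)).2.1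
  · exact fun i t => hconst i _ (hmem t)
  · intro t s hts
    by_contra! hcon
    refine hts (Subtype.ext ?_)
    ext i
    have h1 := hfG _ (hmem t) (Sum.inr i)
    have h2 := hfG _ (hmem s) (Sum.inr i)
    have h3 := hcon i
    simp only [hGdef, Sum.elim_inr, L, Pi.add_apply] at h1 h2
    rw [h1, h2] at h3
    simpa [hε.ne'] using h3

/-- Given finitely many polynomial functions `Φ` and a set `T` of polynomial functions whose
differentials span, at some point, a space of dimension at least `card ι + d`, a generic point
lies in a `d`-parameter family of points with equal values of `Φ` that are separated by `T`. -/
theorem exists_generic_level_family {ι : Type*} [Fintype ι] {d : ℕ}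
    {Φ : ι → V → ℝ} (hΦ : ∀ i, IsPolyFun (Φ i)) {T : Set (V → ℝ)} (hT : ∀ f ∈ T, IsPolyFun f)
    (x₀ : V) (hd : Fintype.card ι + d ≤
      Module.finrank ℝ (Submodule.span ℝ ((fun f => fderiv ℝ f x₀) '' T))) :
    ∃ P : V → ℝ, IsPolyFun P ∧ (∃ x, P x ≠ 0) ∧ ∀ j, P j ≠ 0 → ∀ U ∈ 𝓝 j,
      ∃ F : Metric.ball (0 : EuclideanSpace ℝ (Fin d)) 1 → V, Continuous F ∧
        F ⟨0, by simp⟩ = j ∧ (∀ t, F t ∈ U) ∧ (∀ i t, Φ i (F t) = Φ i j) ∧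
        ∀ t s, t ≠ s → ∃ f ∈ T, f (F t) ≠ f (F s) := by
  classical
  let S : Set (Finset ι) :=
    {I | ∃ x, LinearIndependent ℝ fun a : I => fderiv ℝ (Φ a) x}
  have hSne : S.Nonempty := ⟨∅, x₀, linearIndependent_empty_type⟩
  obtain ⟨I, hI⟩ := S.toFinite.exists_maximal hSne
  obtain ⟨x₁, hx₁⟩ := hI.prop
  have hmax : ∀ x, LinearIndependent ℝ (fun a : I => fderiv ℝ (Φ a) x) →
      ∀ i, fderiv ℝ (Φ i) x ∈ Submodule.span ℝ (Set.range fun a : I => fderiv ℝ (Φ a) x) := by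
    intro x hx i
    by_contra hi
    have hiI : i ∉ (I : Set ι) := fun h => hi (Submodule.subset_span ⟨⟨i, h⟩, rfl⟩)
    have hins : LinearIndepOn ℝ (fun i => fderiv ℝ (Φ i) x) (insert i (I : Set ι)) := by
      rw [linearIndepOn_insert hiI]
      refine ⟨hx, ?_⟩
      rwa [Set.image_eq_range]
    have hmem : insert i I ∈ S := by
      refine ⟨x, ?_⟩
      rw [← Finset.coe_insert] at hins
      exact hins
    exact hiI (hI.le_of_ge hmem (Finset.subset_insert i I) (Finset.mem_insert_self i I))
  obtain ⟨v₁, hv₁⟩ := exists_dual_vectors hx₁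
  obtain ⟨f, hf, -, hfi⟩ := Submodule.exists_fun_fin_finrank_span_eq ℝ
    ((fun f => fderiv ℝ f x₀) '' T)
  choose τ hτ hτf using hf
  have hτi : LinearIndependent ℝ fun i => fderiv ℝ (τ i) x₀ := by
    have : (fun i => fderiv ℝ (τ i) x₀) = f := funext hτf
    rwa [this]
  obtain ⟨v₀, hv₀⟩ := exists_dual_vectors hτi
  obtain ⟨x, hx⟩ := IsPolyFun.exists_mul_ne_zero
    (IsPolyFun.det (M := fun x => Matrix.of fun (a : I) b => fderiv ℝ (Φ a) x (v₁ b))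
      fun a b => (hΦ a).fderiv_apply (v₁ b))
    (IsPolyFun.det (M := fun x => Matrix.of fun a b => fderiv ℝ (τ a) x (v₀ b))
      fun a b => (hT _ (hτ a)).fderiv_apply (v₀ b))
    ⟨x₁, by simp only [hv₁, Matrix.det_one]; exact one_ne_zero⟩
    ⟨x₀, by simp only [hv₀, Matrix.det_one]; exact one_ne_zero⟩
  have hxI := linearIndependent_of_det_ne_zero (left_ne_zero_of_mul hx)
  have hxτ := linearIndependent_of_det_ne_zero (right_ne_zero_of_mul hx)
  have hspan := finrank_span_eq_card hxτ
  rw [Fintype.card_fin] at hspan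
  obtain ⟨h, hh, hind⟩ := exists_linearIndependent_sumElim (d := d) hxI
    (Set.range fun i => fderiv ℝ (τ i) x) (by
      have : Fintype.card I ≤ Fintype.card ι := Fintype.card_subtype_le _
      omega)
  choose c hc using hh
  have hind' : LinearIndependent ℝ fun a : I ⊕ Fin d =>
      fderiv ℝ (Sum.elim (Φ ∘ Subtype.val) (fun i => τ (c i)) a) x := by
    have e : (fun a : I ⊕ Fin d =>
        fderiv ℝ (Sum.elim (Φ ∘ Subtype.val) (fun i => τ (c i)) a) x) =
        Sum.elim (fun a : I => fderiv ℝ (Φ a) x) h := by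
      ext (a | i) : 1
      · rfl
      · exact hc i
    rwa [e]
  obtain ⟨v, hv⟩ := exists_dual_vectors hind'
  refine ⟨fun x => (Matrix.of fun a b => fderiv ℝ
    (Sum.elim (Φ ∘ (Subtype.val : I → ι)) (fun i => τ (c i)) a) x (v b)).det, ?_, ⟨x, ?_⟩, ?_⟩
  · refine IsPolyFun.det fun a b => IsPolyFun.fderiv_apply ?_ _
    rcases a with a | i
    · exact hΦ _
    · exact hT _ (hτ _)
  · simp only [hv, Matrix.det_one]
    exact one_ne_zero
  · intro j hj U hU
    obtain ⟨F, h1, h2, h3, h4, h5⟩ :=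
      exists_level_family hΦ (fun i => hT _ (hτ (c i))) hmax hj hU
    refine ⟨F, h1, h2, h3, h4, fun t s hts => ?_⟩
    obtain ⟨i, hi⟩ := h5 t s hts
    exact ⟨_, hτ (c i), hi⟩

end LocalFamily

section OrthogonalConjugacy

open Matrix

variable {n : Type*} [Fintype n] [DecidableEq n]

theorem charpoly_smul_eq_of_charpoly_eq {K : Type*} [Field K] [Infinite K] {A B : Matrix n n K}
    (h : A.charpoly = B.charpoly) {c : K} (hc : c ≠ 0) :
    (c • A).charpoly = (c • B).charpoly := by
  have key : ∀ (M : Matrix n n K) (x : K), (c • M).charpoly.eval x =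
      c ^ Fintype.card n * M.charpoly.eval (c⁻¹ * x) := by
    intro M x
    rw [Matrix.eval_charpoly, Matrix.eval_charpoly, ← Matrix.det_smul]
    congr 1
    rw [smul_sub]
    congr 1
    ext a b
    by_cases hab : a = b <;> simp [hab, hc]
  refine Polynomial.funext fun x => ?_
  rw [key, key, h]

/-- Real matrices that are similar over `ℂ` are similar over `ℝ`. -/
theorem exists_real_intertwiner {A B : Matrix n n ℝ} {V : Matrix n n ℂ} (hV : V.det ≠ 0)
    (h : V * A.map Complex.ofReal = B.map Complex.ofReal * V) :
    ∃ S : Matrix n n ℝ, S.det ≠ 0 ∧ S * A = B * S := by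
  let X : Matrix n n ℝ := V.map Complex.re
  let Y : Matrix n n ℝ := V.map Complex.im
  have hX : X * A = B * X := by
    ext a b
    have := congrArg Complex.re (congrFun (congrFun h a) b)
    simpa [Matrix.mul_apply, X] using this
  have hY : Y * A = B * Y := by
    ext a b
    have := congrArg Complex.im (congrFun (congrFun h a) b)
    simpa [Matrix.mul_apply, Y] using this
  let p : Polynomial ℝ :=
    (Matrix.of fun a b => Polynomial.C (X a b) + Polynomial.X * Polynomial.C (Y a b)).det
  have hp : p ≠ 0 := by
    intro hp
    have h1 : Polynomial.eval₂RingHom Complex.ofRealHom Complex.I p = V.det := by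
      rw [RingHom.map_det]
      congr 1
      ext a b
      simp only [RingHom.mapMatrix_apply, Matrix.map_apply, Matrix.of_apply,
        Polynomial.coe_eval₂RingHom, Polynomial.eval₂_add, Polynomial.eval₂_mul,
        Polynomial.eval₂_C, Polynomial.eval₂_X, Complex.ofRealHom_eq_coe, X, Y]
      rw [mul_comm, Complex.re_add_im]
    rw [hp, map_zero] at h1
    exact hV h1.symm
  have hev : ∀ t, p.eval t = (X + t • Y).det := by
    intro t
    rw [← Polynomial.coe_evalRingHom, RingHom.map_det]
    congr 1
    ext a b
    simp [mul_comm (Y a b)]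
  obtain ⟨t, ht⟩ : ∃ t, p.eval t ≠ 0 := by
    by_contra! hcon
    exact hp (Polynomial.funext fun t => by simp [hcon t])
  refine ⟨X + t • Y, by rwa [← hev], ?_⟩
  rw [Matrix.add_mul, Matrix.mul_add, Matrix.smul_mul, Matrix.mul_smul, hX, hY]

/-- An invertible intertwiner of skew-symmetric matrices can be replaced by an orthogonal one. -/
theorem exists_orthogonal_intertwiner {A B S : Matrix n n ℝ} (hA : Aᵀ = -A) (hB : Bᵀ = -B)
    (hS : S.det ≠ 0) (h : S * A = B * S) :
    ∃ O ∈ Matrix.orthogonalGroup n ℝ, O * A = B * O := by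
  have hSu : IsUnit S := (Matrix.isUnit_iff_isUnit_det S).2 (isUnit_iff_ne_zero.2 hS)
  have hK : (Sᵀ * S).PosDef := by
    have := Matrix.PosDef.conjTranspose_mul_self S (Matrix.mulVec_injective_iff_isUnit.2 hSu)
    simpa using this
  have hT : A * Sᵀ = Sᵀ * B := by
    have := congrArg Matrix.transpose h
    rw [Matrix.transpose_mul, Matrix.transpose_mul, hA, hB] at this
    simpa using this
  have hcomm : A * (Sᵀ * S) = (Sᵀ * S) * A := by
    rw [← Matrix.mul_assoc, hT, Matrix.mul_assoc, Matrix.mul_assoc, h]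
  set Q : Matrix n n ℝ := (hK.isHermitian.eigenvectorUnitary : Matrix n n ℝ) with hQ
  set κ := hK.isHermitian.eigenvalues with hκ
  have hQ1 : Q * Qᵀ = 1 := (Matrix.mem_unitaryGroup_iff).1 hK.isHermitian.eigenvectorUnitary.2
  have hQ2 : Qᵀ * Q = 1 := (Matrix.mem_unitaryGroup_iff').1 hK.isHermitian.eigenvectorUnitary.2
  have hspec : Sᵀ * S = Q * Matrix.diagonal κ * Qᵀ := hK.isHermitian.spectral_theorem
  have hκpos : ∀ i, 0 < κ i := hK.eigenvalues_pos
  let f : n → ℝ := fun i => (Real.sqrt (κ i))⁻¹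
  let N := Q * Matrix.diagonal f * Qᵀ
  have hC : Qᵀ * A * Q * Matrix.diagonal κ = Matrix.diagonal κ * (Qᵀ * A * Q) := by
    have h1 : Qᵀ * (A * (Sᵀ * S)) * Q = Qᵀ * ((Sᵀ * S) * A) * Q := by rw [hcomm]
    rw [hspec] at h1
    calc Qᵀ * A * Q * Matrix.diagonal κ
        = Qᵀ * A * Q * Matrix.diagonal κ * (Qᵀ * Q) := by rw [hQ2, Matrix.mul_one]
      _ = Qᵀ * (A * (Q * Matrix.diagonal κ * Qᵀ)) * Q := by simp only [Matrix.mul_assoc]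
      _ = (Qᵀ * Q) * Matrix.diagonal κ * (Qᵀ * A * Q) := by
        rw [h1]; simp only [Matrix.mul_assoc]
      _ = _ := by rw [hQ2, Matrix.one_mul]
  have hC' : Qᵀ * A * Q * Matrix.diagonal f = Matrix.diagonal f * (Qᵀ * A * Q) := by
    ext a b
    have := congrFun (congrFun hC a) b
    rw [Matrix.mul_diagonal, Matrix.diagonal_mul] at this ⊢
    by_cases hab : κ a = κ b
    · simp only [f, hab]; ring
    · have h0 : (Qᵀ * A * Q) a b = 0 := by
        have : (κ b - κ a) * (Qᵀ * A * Q) a b = 0 := by linear_combination this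
        rcases mul_eq_zero.1 this with h | h
        · exact absurd (by linarith) hab
        · exact h
      rw [h0]; ring
  have hN : N * A = A * N := by
    calc N * A = Q * Matrix.diagonal f * Qᵀ * A * (Q * Qᵀ) := by rw [hQ1, Matrix.mul_one]
      _ = Q * (Matrix.diagonal f * (Qᵀ * A * Q)) * Qᵀ := by simp only [Matrix.mul_assoc]
      _ = (Q * Qᵀ) * A * (Q * Matrix.diagonal f * Qᵀ) := by
        rw [← hC']; simp only [Matrix.mul_assoc]
      _ = A * N := by rw [hQ1, Matrix.one_mul]
  refine ⟨S * N, ?_, ?_⟩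
  · rw [Matrix.mem_orthogonalGroup_iff']
    have hNt : Nᵀ = N := by
      simp [N, Matrix.transpose_mul, Matrix.mul_assoc]
    have hdiag : Matrix.diagonal f * Matrix.diagonal κ * Matrix.diagonal f = 1 := by
      rw [Matrix.diagonal_mul_diagonal, Matrix.diagonal_mul_diagonal, ← Matrix.diagonal_one]
      congr 1
      ext i
      have h1 := Real.mul_self_sqrt (hκpos i).le
      have h2 := (Real.sqrt_pos.2 (hκpos i)).ne'
      simp only [f]
      field_simp
      nlinarith
    calc star (S * N) * (S * N) = N * (Sᵀ * S) * N := by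
          rw [Matrix.star_eq_conjTranspose, Matrix.conjTranspose_eq_transpose_of_trivial,
            Matrix.transpose_mul, hNt]
          simp only [Matrix.mul_assoc]
      _ = Q * Matrix.diagonal f * (Qᵀ * Q) * Matrix.diagonal κ * (Qᵀ * Q) *
          Matrix.diagonal f * Qᵀ := by
          rw [hspec]; simp only [N, Matrix.mul_assoc]
      _ = Q * (Matrix.diagonal f * Matrix.diagonal κ * Matrix.diagonal f) * Qᵀ := by
          rw [hQ2]; simp only [Matrix.mul_assoc, Matrix.mul_one]
      _ = 1 := by rw [hdiag, Matrix.mul_one, hQ1]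
  · rw [Matrix.mul_assoc, hN, ← Matrix.mul_assoc, h, Matrix.mul_assoc]

/-- Real skew-symmetric matrices with equal characteristic polynomials are orthogonally
conjugate. -/
theorem exists_orthogonal_conj_of_charpoly_eq {A B : Matrix n n ℝ} (hA : Aᵀ = -A) (hB : Bᵀ = -B)
    (h : A.charpoly = B.charpoly) : ∃ O ∈ Matrix.orthogonalGroup n ℝ, O * A = B * O := by
  have herm : ∀ M : Matrix n n ℝ, Mᵀ = -M →
      (Complex.I • M.map Complex.ofReal).IsHermitian := by
    intro M hM
    ext a b
    have : M b a = - M a b := congrFun (congrFun hM a) b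
    simp [this]
  have hc : (Complex.I • A.map Complex.ofReal).charpoly =
      (Complex.I • B.map Complex.ofReal).charpoly := by
    refine charpoly_smul_eq_of_charpoly_eq ?_ Complex.I_ne_zero
    have h1 := Matrix.charpoly_map A Complex.ofRealHom
    have h2 := Matrix.charpoly_map B Complex.ofRealHom
    rw [h, ← h2] at h1
    exact h1
  have hev := ((herm A hA).eigenvalues_eq_eigenvalues_iff (herm B hB)).2 hc
  set H := herm A hA
  set H' := herm B hB
  let U : Matrix n n ℂ := H.eigenvectorUnitary
  let U' : Matrix n n ℂ := H'.eigenvectorUnitary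
  have hU : star U * U = 1 := (Matrix.mem_unitaryGroup_iff').1 H.eigenvectorUnitary.2
  have hU' : star U' * U' = 1 := (Matrix.mem_unitaryGroup_iff').1 H'.eigenvectorUnitary.2
  have hs : Complex.I • A.map Complex.ofReal =
      U * Matrix.diagonal (RCLike.ofReal ∘ H.eigenvalues) * star U := H.spectral_theorem
  have hs' : Complex.I • B.map Complex.ofReal =
      U' * Matrix.diagonal (RCLike.ofReal ∘ H.eigenvalues) * star U' := by
    rw [hev]; exact H'.spectral_theorem
  have hmul : Complex.I • (U' * star U * A.map Complex.ofReal) =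
      Complex.I • (B.map Complex.ofReal * (U' * star U)) := by
    rw [← Matrix.mul_smul, ← Matrix.smul_mul, hs, hs']
    calc _ = U' * (star U * U) * Matrix.diagonal (RCLike.ofReal ∘ H.eigenvalues) * star U := by
          simp only [Matrix.mul_assoc]
      _ = U' * Matrix.diagonal (RCLike.ofReal ∘ H.eigenvalues) * (star U' * U') * star U := by
          rw [hU, hU']; simp only [Matrix.mul_assoc, Matrix.one_mul]
      _ = _ := by simp only [Matrix.mul_assoc]
  have hdet : (U' * star U).det ≠ 0 := by
    have h1 := congrArg Matrix.det hU
    have h2 := congrArg Matrix.det hU'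
    rw [Matrix.det_mul, Matrix.det_one] at h1 h2
    rw [Matrix.det_mul]
    exact mul_ne_zero (right_ne_zero_of_mul (h2 ▸ one_ne_zero))
      (left_ne_zero_of_mul (h1 ▸ one_ne_zero))
  obtain ⟨S, hS, hSA⟩ := exists_real_intertwiner hdet
    (smul_right_injective _ Complex.I_ne_zero hmul)
  exact exists_orthogonal_intertwiner hA hB hS hSA

end OrthogonalConjugacy

section MatrixAlgebra

open Matrix

variable {n : Type*} [Fintype n] [DecidableEq n]

/-- Every derivation of a matrix algebra is inner. -/
theorem exists_commutator_of_leibniz [Nonempty n] (D : Matrix n n ℝ →ₗ[ℝ] Matrix n n ℝ)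
    (hD : ∀ x y, D (x * y) = D x * y + x * D y) :
    ∃ ξ : Matrix n n ℝ, ∀ x, D x = ξ * x - x * ξ := by
  obtain ⟨o⟩ := ‹Nonempty n›
  let E : n → n → Matrix n n ℝ := fun a b => Matrix.single a b 1
  have hsum : ∑ i, E i o * E o i = 1 := by
    simp only [E, Matrix.single_mul_single_same, mul_one]
    exact Matrix.sum_single_one
  have hl : ∀ x i, x * E i o = ∑ a, x a i • E a o := by
    intro x i
    ext b c
    simp only [E, Matrix.sum_apply, Matrix.smul_apply, Matrix.single_apply, Matrix.mul_apply]
    by_cases hc : o = c <;> simp [hc]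
  have hr : ∀ x i, E o i * x = ∑ b, x i b • E o b := by
    intro x i
    ext b c
    simp only [E, Matrix.sum_apply, Matrix.smul_apply, Matrix.single_apply, Matrix.mul_apply]
    by_cases hc : o = b <;> simp [hc]
  refine ⟨∑ i, D (E i o) * E o i, fun x => ?_⟩
  have h1 : (∑ i, D (E i o) * E o i) * x = ∑ i, D (x * E i o) * E o i := by
    simp_rw [Finset.sum_mul, Matrix.mul_assoc, hr, hl, map_sum, map_smul, Finset.sum_mul,
      Finset.mul_sum, Matrix.smul_mul, Matrix.mul_smul]
    exact Finset.sum_comm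
  have h2 : ∑ i, D (x * E i o) * E o i = D x + x * ∑ i, D (E i o) * E o i := by
    simp_rw [hD, add_mul, Finset.sum_add_distrib, Matrix.mul_assoc, ← Finset.mul_sum, hsum,
      Matrix.mul_one]
  rw [h1, h2, add_sub_cancel_right]

/-- The skew-symmetric matrices. -/
def skewMatrices (n : Type*) : Submodule ℝ (Matrix n n ℝ) where
  carrier := {A | Aᵀ = -A}
  add_mem' := by
    intro a b ha hb
    simp only [Set.mem_ofPred_eq, Matrix.transpose_add] at *
    rw [ha, hb, neg_add]
  zero_mem' := by simp
  smul_mem' := by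
    intro c a ha
    simp only [Set.mem_ofPred_eq, Matrix.transpose_smul] at *
    rw [ha, smul_neg]

theorem mem_skewMatrices {n : Type*} {A : Matrix n n ℝ} : A ∈ skewMatrices n ↔ Aᵀ = -A := Iff.rfl

theorem commutator_mem_skewMatrices {n : Type*} [Fintype n] {A B : Matrix n n ℝ}
    (hA : A ∈ skewMatrices n)
    (hB : B ∈ skewMatrices n) : A * B - B * A ∈ skewMatrices n := by
  rw [mem_skewMatrices] at *
  rw [Matrix.transpose_sub, Matrix.transpose_mul, Matrix.transpose_mul, hA, hB]
  simp

theorem le_finrank_skewMatrices (m : ℕ) :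
    m * (m - 1) / 2 ≤ Module.finrank ℝ (skewMatrices (Fin m)) := by
  let ι := {p : Fin m × Fin m // p.1 < p.2}
  have hcard : Fintype.card ι = m * (m - 1) / 2 := by
    rw [Fintype.card_subtype, Finset.card_filter, Fintype.sum_prod_type_right,
      ← Finset.sum_range_id, ← Fin.sum_univ_eq_sum_range (fun i => i) m]
    refine Finset.sum_congr rfl fun b _ => ?_
    rw [← Finset.card_filter]
    exact (congrArg Finset.card (by ext; simp)).trans (Fin.card_Iio b)
  let T : (ι → ℝ) →ₗ[ℝ] Matrix (Fin m) (Fin m) ℝ :=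
    ∑ p : ι, (LinearMap.proj (R := ℝ) (φ := fun _ : ι => ℝ) p).smulRight
      (Matrix.single p.1.1 p.1.2 1 - Matrix.single p.1.2 p.1.1 1)
  have hT : ∀ c, T c ∈ skewMatrices (Fin m) := by
    intro c
    simp only [T, LinearMap.sum_apply, LinearMap.smulRight_apply]
    refine Submodule.sum_mem _ fun p _ => Submodule.smul_mem _ _ ?_
    rw [mem_skewMatrices]
    simp
  have hTc : ∀ c (p : ι), T c p.1.1 p.1.2 = c p := by
    rintro c ⟨⟨a, b⟩, hab⟩
    simp only [T, LinearMap.sum_apply, LinearMap.smulRight_apply, Matrix.sum_apply,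
      Matrix.smul_apply, Matrix.sub_apply, Matrix.single_apply, LinearMap.proj_apply]
    rw [Finset.sum_eq_single ⟨(a, b), hab⟩]
    · have : ¬ (b = a ∧ a = b) := fun h => hab.ne h.2
      simp [this]
    · rintro ⟨⟨a', b'⟩, hab'⟩ _ hne
      have h1 : ¬ (a' = a ∧ b' = b) := by
        rintro ⟨rfl, rfl⟩
        exact hne rfl
      have h2 : ¬ (b' = a ∧ a' = b) := by
        rintro ⟨rfl, rfl⟩
        exact lt_asymm hab hab'
      simp [h1, h2]
    · simp
  rw [← hcard, ← Module.finrank_fintype_fun_eq_card ℝ]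
  refine LinearMap.finrank_le_finrank_of_injective (f := T.codRestrict _ hT) ?_
  intro c c' hcc
  ext p
  rw [← hTc c, ← hTc c', show T c = T c' from congrArg Subtype.val hcc]

/-- The infinitesimal rotation of the plane spanned by two coordinate vectors. -/
def planeRotation {n : Type*} [DecidableEq n] (a b : n) : Matrix n n ℝ :=
  Matrix.single a b 1 - Matrix.single b a 1

theorem planeRotation_mem {n : Type*} [DecidableEq n] (a b : n) :
    planeRotation a b ∈ skewMatrices n := by
  rw [mem_skewMatrices]
  simp [planeRotation]

/-- The skew-symmetric signed adjacency matrix of a path. -/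
def skewPath (m : ℕ) : Matrix (Fin m) (Fin m) ℝ :=
  Matrix.of fun a b => if a.val + 1 = b.val then 1 else if b.val + 1 = a.val then -1 else 0

theorem skewPath_mem (m : ℕ) : skewPath m ∈ skewMatrices (Fin m) := by
  rw [mem_skewMatrices]
  ext a b
  simp only [skewPath, Matrix.transpose_apply, Matrix.of_apply, Matrix.neg_apply]
  split_ifs <;> first | omega | simp

/-- A plane rotation and the skew path generate the full matrix algebra. -/
theorem subalgebra_eq_top_of_mem {m : ℕ} (hm : 3 ≤ m)
    {S : Subalgebra ℝ (Matrix (Fin m) (Fin m) ℝ)}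
    (hA : planeRotation (⟨0, by omega⟩ : Fin m) ⟨1, by omega⟩ ∈ S) (hB : skewPath m ∈ S) :
    S = ⊤ := by
  set o : Fin m := ⟨0, by omega⟩ with ho
  set A := planeRotation o ⟨1, by omega⟩ with hAdef
  set B := skewPath m with hBdef
  let E : Fin m → Fin m → Matrix (Fin m) (Fin m) ℝ := fun a b => Matrix.single a b 1
  have hrow : ∀ (i k : Fin m) (M : Matrix (Fin m) (Fin m) ℝ) a b,
      (E i k * M) a b = if i = a then M k b else 0 := by
    intro i k M a b
    by_cases h : i = a <;> simp [E, Matrix.mul_apply, Matrix.single_apply, h]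
  have hcol : ∀ (i k : Fin m) (M : Matrix (Fin m) (Fin m) ℝ) a b,
      (M * E i k) a b = if k = b then M a i else 0 := by
    intro i k M a b
    by_cases h : k = b <;> simp [E, Matrix.mul_apply, Matrix.single_apply, h]
  have hAl : ∀ (M : Matrix (Fin m) (Fin m) ℝ) a b, (A * M) a b =
      (if o = a then M ⟨1, by omega⟩ b else 0) - if ⟨1, by omega⟩ = a then M o b else 0 := by
    intro M a b
    rw [← hrow, ← hrow, ← Matrix.sub_apply, ← sub_mul]
    rfl
  have hAr : ∀ (M : Matrix (Fin m) (Fin m) ℝ) a b, (M * A) a b =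
      (if ⟨1, by omega⟩ = b then M a o else 0) - if o = b then M a ⟨1, by omega⟩ else 0 := by
    intro M a b
    rw [← hcol, ← hcol, ← Matrix.sub_apply, ← mul_sub]
    rfl
  have h02 : E o ⟨2, by omega⟩ = A * B - A * A := by
    ext a b
    rw [Matrix.sub_apply, hAl, hAl]
    simp only [E, hAdef, hBdef, ho, planeRotation, skewPath, Matrix.of_apply, Matrix.sub_apply,
      Matrix.single_apply, Fin.ext_iff]
    grind
  have h20 : E ⟨2, by omega⟩ o = B * A - A * A := by
    ext a b
    rw [Matrix.sub_apply, hAr, hAr]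
    simp only [E, hAdef, hBdef, ho, planeRotation, skewPath, Matrix.of_apply, Matrix.sub_apply,
      Matrix.single_apply, Fin.ext_iff]
    grind
  have h00 : E o o ∈ S := by
    have : E o o = E o ⟨2, by omega⟩ * E ⟨2, by omega⟩ o := by simp [E]
    rw [this, h02, h20]
    exact S.mul_mem (S.sub_mem (S.mul_mem hA hB) (S.mul_mem hA hA))
      (S.sub_mem (S.mul_mem hB hA) (S.mul_mem hA hA))
  have h01 : E o ⟨1, by omega⟩ = E o o * A := by
    ext a b
    rw [hrow]
    simp [E, hAdef, planeRotation, Matrix.single_apply, ho]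
    grind
  have h10 : E ⟨1, by omega⟩ o = - (A * E o o) := by
    ext a b
    rw [Matrix.neg_apply, hcol]
    simp [E, hAdef, planeRotation, Matrix.single_apply, ho]
    grind
  have hmem : ∀ k (hk : k < m), (E o ⟨k, hk⟩ ∈ S ∧ E ⟨k, hk⟩ o ∈ S) := by
    intro k
    induction k using Nat.strong_induction_on with
    | _ k ih =>
      intro hk
      match k, hk, ih with
      | 0, _, _ => exact ⟨h00, h00⟩
      | 1, _, _ => exact ⟨h01 ▸ S.mul_mem h00 hA, h10 ▸ S.neg_mem (S.mul_mem hA h00)⟩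
      | k + 2, hk, ih =>
        have e1 : E o ⟨k + 2, hk⟩ = E o ⟨k + 1, by omega⟩ * B + E o ⟨k, by omega⟩ := by
          ext a b
          rw [Matrix.add_apply, hrow]
          simp only [E, hBdef, skewPath, Matrix.of_apply, Matrix.single_apply, Fin.ext_iff]
          grind
        have e2 : E ⟨k + 2, hk⟩ o = E ⟨k, by omega⟩ o - B * E ⟨k + 1, by omega⟩ o := by
          ext a b
          rw [Matrix.sub_apply, hcol]
          simp only [E, hBdef, skewPath, Matrix.of_apply, Matrix.single_apply, Fin.ext_iff]
          grind
        have i1 := ih (k + 1) (by omega) (by omega)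
        have i0 := ih k (by omega) (by omega)
        exact ⟨e1 ▸ S.add_mem (S.mul_mem i1.1 hB) i0.1, e2 ▸ S.sub_mem i0.2 (S.mul_mem hB i1.2)⟩
  refine eq_top_iff.2 fun M _ => ?_
  rw [Matrix.matrix_eq_sum_single M]
  refine S.sum_mem fun a _ => S.sum_mem fun b _ => ?_
  have : Matrix.single a b (M a b) = M a b • (E a o * E o b) := by simp [E, Matrix.smul_single]
  rw [this]
  exact S.smul_mem (S.mul_mem (hmem a a.2).2 (hmem b b.2).1) _

end MatrixAlgebra

section MatrixModel

open Matrix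

variable {m : ℕ}

noncomputable instance (m : ℕ) : AddCommGroup (Wso m) :=
  @Submodule.addCommGroup ℝ (EuclideanSpace ℝ (Fin 2) →L[ℝ]
    (EuclideanSpace ℝ (Fin m) →L[ℝ] EuclideanSpace ℝ (Fin m))) _ _ _ (Wso m)

noncomputable instance (m : ℕ) : NormedAddCommGroup (Wso m) :=
  @Submodule.normedAddCommGroup ℝ (EuclideanSpace ℝ (Fin 2) →L[ℝ]
    (EuclideanSpace ℝ (Fin m) →L[ℝ] EuclideanSpace ℝ (Fin m))) _ _ _ (Wso m)

noncomputable instance (m : ℕ) : NormedSpace ℝ (Wso m) :=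
  @Submodule.normedSpace ℝ ℝ _ _ _ (EuclideanSpace ℝ (Fin 2) →L[ℝ]
    (EuclideanSpace ℝ (Fin m) →L[ℝ] EuclideanSpace ℝ (Fin m))) _ _ _ _ (Wso m)

instance (m : ℕ) : FiniteDimensional ℝ (Wso m) :=
  @FiniteDimensional.finiteDimensional_submodule ℝ (EuclideanSpace ℝ (Fin 2) →L[ℝ]
    (EuclideanSpace ℝ (Fin m) →L[ℝ] EuclideanSpace ℝ (Fin m))) _ _ _ _ (Wso m)

/-- The matrix of the endomorphism `j(Z)`. -/
noncomputable def matAt (Z : EuclideanSpace ℝ (Fin 2)) :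
    Wso m →ₗ[ℝ] Matrix (Fin m) (Fin m) ℝ where
  toFun j := (toEuclideanCLM (n := Fin m) (𝕜 := ℝ)).symm (j.1 Z)
  map_add' j j' := by simp
  map_smul' c j := by simp

theorem toEuclideanCLM_matAt (Z : EuclideanSpace ℝ (Fin 2)) (j : Wso m) :
    toEuclideanCLM (n := Fin m) (𝕜 := ℝ) (matAt Z j) = j.1 Z :=
  StarAlgEquiv.apply_symm_apply _ _

theorem matAt_add (Z Z' : EuclideanSpace ℝ (Fin 2)) (j : Wso m) :
    matAt (Z + Z') j = matAt Z j + matAt Z' j := by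
  simp [matAt]

theorem matAt_smul (c : ℝ) (Z : EuclideanSpace ℝ (Fin 2)) (j : Wso m) :
    matAt (c • Z) j = c • matAt Z j := by
  simp [matAt]

theorem matAt_neg (Z : EuclideanSpace ℝ (Fin 2)) (j : Wso m) : matAt (-Z) j = - matAt Z j := by
  simp [matAt]

theorem matAt_mem (Z : EuclideanSpace ℝ (Fin 2)) (j : Wso m) :
    matAt Z j ∈ skewMatrices (Fin m) := by
  rw [mem_skewMatrices, ← conjTranspose_eq_transpose_of_trivial, ← star_eq_conjTranspose]
  apply EquivLike.injective (toEuclideanCLM (n := Fin m) (𝕜 := ℝ))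
  rw [map_star, map_neg, toEuclideanCLM_matAt, ContinuousLinearMap.star_eq_adjoint, eq_comm,
    ContinuousLinearMap.eq_adjoint_iff]
  intro x y
  rw [_root_.neg_apply, inner_neg_left, j.2 Z x y, neg_neg]

theorem matAt_eq (Z : EuclideanSpace ℝ (Fin 2)) (j : Wso m) :
    matAt Z j = Z 0 • matAt !₂[1, 0] j + Z 1 • matAt !₂[0, 1] j := by
  rw [← matAt_smul, ← matAt_smul, ← matAt_add]
  have h : Z = Z 0 • !₂[1, 0] + Z 1 • !₂[0, 1] := by
    ext i
    fin_cases i <;> simp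
  rw [← h]

theorem eq_of_matAt_eq {j j' : Wso m} (h0 : matAt !₂[1, 0] j = matAt !₂[1, 0] j')
    (h1 : matAt !₂[0, 1] j = matAt !₂[0, 1] j') : j = j' := by
  refine Subtype.ext (ContinuousLinearMap.ext fun Z => ?_)
  rw [← toEuclideanCLM_matAt, ← toEuclideanCLM_matAt, matAt_eq, h0, h1, ← matAt_eq]

theorem inner_toEuclideanCLM_of_skew {A : Matrix (Fin m) (Fin m) ℝ}
    (hA : A ∈ skewMatrices (Fin m)) (x y : EuclideanSpace ℝ (Fin m)) :
    ⟪toEuclideanCLM (n := Fin m) (𝕜 := ℝ) A x, y⟫ =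
      -⟪x, toEuclideanCLM (n := Fin m) (𝕜 := ℝ) A y⟫ := by
  have h : star A = -A := by
    rw [star_eq_conjTranspose, conjTranspose_eq_transpose_of_trivial]
    exact hA
  have h' := congrArg (toEuclideanCLM (n := Fin m) (𝕜 := ℝ)) h
  rw [map_star, map_neg, ContinuousLinearMap.star_eq_adjoint] at h'
  rw [← ContinuousLinearMap.adjoint_inner_right, h', _root_.neg_apply, inner_neg_right]

/-- The element of `Wso m` sending the standard basis vectors to a given pair of skew-symmetric
matrices. -/
noncomputable def ofPair : skewMatrices (Fin m) × skewMatrices (Fin m) →ₗ[ℝ] Wso m where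
  toFun p :=
    ⟨(EuclideanSpace.proj (0 : Fin 2)).smulRight (toEuclideanCLM (n := Fin m) (𝕜 := ℝ) p.1.1) +
      (EuclideanSpace.proj (1 : Fin 2)).smulRight (toEuclideanCLM (n := Fin m) (𝕜 := ℝ) p.2.1), by
      intro Z x y
      show ⟪Z 0 • toEuclideanCLM (n := Fin m) (𝕜 := ℝ) p.1.1 x +
          Z 1 • toEuclideanCLM (n := Fin m) (𝕜 := ℝ) p.2.1 x, y⟫ =
        -⟪x, Z 0 • toEuclideanCLM (n := Fin m) (𝕜 := ℝ) p.1.1 y +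
          Z 1 • toEuclideanCLM (n := Fin m) (𝕜 := ℝ) p.2.1 y⟫
      rw [inner_add_left, inner_add_right, real_inner_smul_left, real_inner_smul_left,
        real_inner_smul_right, real_inner_smul_right, inner_toEuclideanCLM_of_skew p.1.2,
        inner_toEuclideanCLM_of_skew p.2.2]
      ring⟩
  map_add' p q := by
    refine Subtype.ext (ContinuousLinearMap.ext fun Z => ?_)
    show Z 0 • toEuclideanCLM (n := Fin m) (𝕜 := ℝ) (p.1.1 + q.1.1) +
        Z 1 • toEuclideanCLM (n := Fin m) (𝕜 := ℝ) (p.2.1 + q.2.1) =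
      (Z 0 • toEuclideanCLM (n := Fin m) (𝕜 := ℝ) p.1.1 +
        Z 1 • toEuclideanCLM (n := Fin m) (𝕜 := ℝ) p.2.1) +
      (Z 0 • toEuclideanCLM (n := Fin m) (𝕜 := ℝ) q.1.1 +
        Z 1 • toEuclideanCLM (n := Fin m) (𝕜 := ℝ) q.2.1)
    rw [map_add, map_add]
    module
  map_smul' c p := by
    refine Subtype.ext (ContinuousLinearMap.ext fun Z => ?_)
    show Z 0 • toEuclideanCLM (n := Fin m) (𝕜 := ℝ) (c • p.1.1) +
        Z 1 • toEuclideanCLM (n := Fin m) (𝕜 := ℝ) (c • p.2.1) =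
      c • (Z 0 • toEuclideanCLM (n := Fin m) (𝕜 := ℝ) p.1.1 +
        Z 1 • toEuclideanCLM (n := Fin m) (𝕜 := ℝ) p.2.1)
    rw [map_smul, map_smul]
    module

theorem matAt_ofPair (Z : EuclideanSpace ℝ (Fin 2))
    (p : skewMatrices (Fin m) × skewMatrices (Fin m)) :
    matAt Z (ofPair p) = Z 0 • p.1.1 + Z 1 • p.2.1 := by
  apply EquivLike.injective (toEuclideanCLM (n := Fin m) (𝕜 := ℝ))
  rw [toEuclideanCLM_matAt, map_add, map_smul, map_smul]
  rfl

theorem exists_orthogonal_matrix (A : EuclideanSpace ℝ (Fin m) ≃ₗᵢ[ℝ] EuclideanSpace ℝ (Fin m)) :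
    ∃ O ∈ orthogonalGroup (Fin m) ℝ, ∀ (j j' : Wso m) (Z Z' : EuclideanSpace ℝ (Fin 2)),
      (∀ x, A (j.1 Z (A.symm x)) = j'.1 Z' x) → O * matAt Z j = matAt Z' j' * O := by
  let u := Unitary.linearIsometryEquiv.symm A
  refine ⟨(toEuclideanCLM (n := Fin m) (𝕜 := ℝ)).symm u.1,
    Unitary.map_mem (toEuclideanCLM (n := Fin m) (𝕜 := ℝ)).symm u.2, fun j j' Z Z' h => ?_⟩
  apply EquivLike.injective (toEuclideanCLM (n := Fin m) (𝕜 := ℝ))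
  rw [map_mul, map_mul, toEuclideanCLM_matAt, toEuclideanCLM_matAt, StarAlgEquiv.apply_symm_apply]
  ext x : 1
  have := h (A x)
  rw [LinearIsometryEquiv.symm_apply_apply] at this
  exact this

theorem exists_isometry_of_orthogonal {O : Matrix (Fin m) (Fin m) ℝ}
    (hO : O ∈ orthogonalGroup (Fin m) ℝ) {j j' : Wso m} {Z : EuclideanSpace ℝ (Fin 2)}
    (h : O * matAt Z j = matAt Z j' * O) :
    ∃ A : EuclideanSpace ℝ (Fin m) ≃ₗᵢ[ℝ] EuclideanSpace ℝ (Fin m),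
      ∀ x, A (j.1 Z (A.symm x)) = j'.1 Z x := by
  let u : unitary (EuclideanSpace ℝ (Fin m) →L[ℝ] EuclideanSpace ℝ (Fin m)) :=
    ⟨toEuclideanCLM (n := Fin m) (𝕜 := ℝ) O, Unitary.map_mem _ hO⟩
  refine ⟨Unitary.linearIsometryEquiv u, fun x => ?_⟩
  have h' := congrArg (toEuclideanCLM (n := Fin m) (𝕜 := ℝ)) h
  rw [map_mul, map_mul, toEuclideanCLM_matAt, toEuclideanCLM_matAt] at h'
  have h2 := congrArg (fun f => f ((Unitary.linearIsometryEquiv u).symm x)) h'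
  refine h2.trans ?_
  show j'.1 Z (Unitary.linearIsometryEquiv u ((Unitary.linearIsometryEquiv u).symm x)) = _
  rw [LinearIsometryEquiv.apply_symm_apply]

end MatrixModel

section Invariants

open Matrix

variable {m : ℕ}

theorem isPolyFun_matAt (Z : EuclideanSpace ℝ (Fin 2)) (a b : Fin m) :
    IsPolyFun (fun j : Wso m => matAt Z j a b) :=
  IsPolyFun.linear ((LinearMap.proj b ∘ₗ LinearMap.proj a : Matrix (Fin m) (Fin m) ℝ →ₗ[ℝ] ℝ) ∘ₗ
    matAt Z)

/-- The polynomial functions that are invariant under simultaneous orthogonal conjugation. -/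
def orthogonalInvariants (m : ℕ) : Set (Wso m → ℝ) :=
  {f | IsPolyFun f ∧ ∀ (j j' : Wso m), ∀ O ∈ orthogonalGroup (Fin m) ℝ,
    (∀ Z, O * matAt Z j = matAt Z j' * O) → f j = f j'}

/-- Evaluation of noncommutative polynomials at the two matrices defining `j`. -/
noncomputable def wordEval (j : Wso m) : FreeAlgebra ℝ (Fin 2) →ₐ[ℝ] Matrix (Fin m) (Fin m) ℝ :=
  FreeAlgebra.lift ℝ ![matAt !₂[1, 0] j, matAt !₂[0, 1] j]

theorem isPolyFun_wordEval (w : FreeAlgebra ℝ (Fin 2)) (a b : Fin m) :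
    IsPolyFun (fun j : Wso m => wordEval j w a b) := by
  induction w using FreeAlgebra.induction generalizing a b with
  | grade0 c =>
    simp only [AlgHom.commutes]
    exact IsPolyFun.const _
  | grade1 i =>
    simp only [wordEval, FreeAlgebra.lift_ι_apply]
    fin_cases i
    · exact isPolyFun_matAt _ a b
    · exact isPolyFun_matAt _ a b
  | mul x y hx hy =>
    simp only [map_mul, Matrix.mul_apply]
    exact IsPolyFun.sum _ fun c _ => (hx a c).mul (hy c b)
  | add x y hx hy =>
    simp only [map_add, Matrix.add_apply]
    exact (hx a b).add (hy a b)

theorem trace_eq_of_orthogonal {O A B : Matrix (Fin m) (Fin m) ℝ}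
    (hO : O ∈ orthogonalGroup (Fin m) ℝ) (h : O * A = B * O) : A.trace = B.trace := by
  have h1 : star O * O = 1 := (mem_unitaryGroup_iff').1 hO
  have h2 : O * star O = 1 := (mem_unitaryGroup_iff).1 hO
  rw [← Matrix.one_mul A, ← h1, Matrix.mul_assoc, h, ← Matrix.mul_assoc, Matrix.trace_mul_cycle,
    h2, Matrix.one_mul]

theorem trace_wordEval_mem (w : FreeAlgebra ℝ (Fin 2)) :
    (fun j : Wso m => (wordEval j w).trace) ∈ orthogonalInvariants m := by
  refine ⟨IsPolyFun.sum _ fun a _ => isPolyFun_wordEval w a a, fun j j' O hO h => ?_⟩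
  refine trace_eq_of_orthogonal hO ?_
  induction w using FreeAlgebra.induction with
  | grade0 c =>
    simp only [AlgHom.commutes]
    exact (Algebra.commutes c O).symm
  | grade1 i =>
    simp only [wordEval, FreeAlgebra.lift_ι_apply]
    fin_cases i
    · exact h _
    · exact h _
  | mul x y hx hy =>
    rw [map_mul, map_mul, ← Matrix.mul_assoc, hx, Matrix.mul_assoc, hy, Matrix.mul_assoc]
  | add x y hx hy =>
    rw [map_add, map_add, mul_add, add_mul, hx, hy]

/-- The derivative of `wordEval` in the direction `X`. -/
noncomputable def wordDeriv (x X : Wso m) :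
    FreeAlgebra ℝ (Fin 2) →ₗ[ℝ] Matrix (Fin m) (Fin m) ℝ where
  toFun w := Matrix.of fun a b => fderiv ℝ (fun j : Wso m => wordEval j w a b) x X
  map_add' w w' := by
    ext a b
    simp only [map_add, Matrix.add_apply, Matrix.of_apply]
    rw [fderiv_fun_add (isPolyFun_wordEval w a b).differentiable.differentiableAt
      (isPolyFun_wordEval w' a b).differentiable.differentiableAt]
    rfl
  map_smul' c w := by
    ext a b
    simp only [map_smul, Matrix.smul_apply, Matrix.of_apply, RingHom.id_apply]
    rw [fderiv_fun_const_smul (isPolyFun_wordEval w a b).differentiable.differentiableAt]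
    rfl

theorem wordDeriv_mul (x X : Wso m) (w w' : FreeAlgebra ℝ (Fin 2)) :
    wordDeriv x X (w * w') = wordDeriv x X w * wordEval x w' + wordEval x w * wordDeriv x X w' := by
  ext a b
  have hd := fun (w : FreeAlgebra ℝ (Fin 2)) (a b : Fin m) =>
    (isPolyFun_wordEval w a b).differentiable.differentiableAt (x := x)
  show fderiv ℝ (fun j : Wso m => wordEval j (w * w') a b) x X = _
  simp only [map_mul, Matrix.mul_apply, Matrix.add_apply]
  rw [fderiv_fun_sum fun c _ => (hd w a c).fun_mul (hd w' c b), _root_.sum_apply,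
    ← Finset.sum_add_distrib]
  refine Finset.sum_congr rfl fun c _ => ?_
  rw [fderiv_fun_mul (hd w a c) (hd w' c b)]
  simp only [wordDeriv, LinearMap.coe_mk, AddHom.coe_mk, Matrix.of_apply, _root_.add_apply,
    FunLike.coe_smul, Pi.smul_apply, smul_eq_mul]
  ring

theorem fderiv_matAt (Z : EuclideanSpace ℝ (Fin 2)) (x X : Wso m) (a b : Fin m) :
    fderiv ℝ (fun j : Wso m => matAt Z j a b) x X = matAt Z X a b := by
  let φ : Wso m →L[ℝ] ℝ := LinearMap.toContinuousLinearMap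
    ((LinearMap.proj b ∘ₗ LinearMap.proj a : Matrix (Fin m) (Fin m) ℝ →ₗ[ℝ] ℝ) ∘ₗ matAt Z)
  exact congrArg (fun f => f X) (φ.fderiv (x := x))

theorem wordDeriv_ι_zero (x X : Wso m) :
    wordDeriv x X (FreeAlgebra.ι ℝ 0) = matAt !₂[1, 0] X := by
  ext a b
  simp only [wordDeriv, LinearMap.coe_mk, AddHom.coe_mk, Matrix.of_apply, wordEval,
    FreeAlgebra.lift_ι_apply]
  exact fderiv_matAt _ x X a b

theorem wordDeriv_ι_one (x X : Wso m) :
    wordDeriv x X (FreeAlgebra.ι ℝ 1) = matAt !₂[0, 1] X := by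
  ext a b
  simp only [wordDeriv, LinearMap.coe_mk, AddHom.coe_mk, Matrix.of_apply, wordEval,
    FreeAlgebra.lift_ι_apply]
  exact fderiv_matAt _ x X a b

/-- A direction annihilated by the differentials of all orthogonal invariants at a generating pair
is tangent to the orbit of that pair. -/
theorem exists_skew_commutator {x X : Wso m} (hx : Function.Surjective (wordEval x)) (hm : 0 < m)
    (hX : ∀ f ∈ orthogonalInvariants m, fderiv ℝ f x X = 0) :
    ∃ ξ ∈ skewMatrices (Fin m), matAt !₂[1, 0] X = ξ * matAt !₂[1, 0] x - matAt !₂[1, 0] x * ξ ∧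
      matAt !₂[0, 1] X = ξ * matAt !₂[0, 1] x - matAt !₂[0, 1] x * ξ := by
  have : Nonempty (Fin m) := ⟨⟨0, hm⟩⟩
  have htr : ∀ w, (wordDeriv x X w).trace = 0 := by
    intro w
    rw [← hX _ (trace_wordEval_mem w)]
    simp only [Matrix.trace, Matrix.diag]
    rw [fderiv_fun_sum fun a _ => (isPolyFun_wordEval w a a).differentiable.differentiableAt,
      _root_.sum_apply]
    rfl
  have hker : ∀ w, wordEval x w = 0 → wordDeriv x X w = 0 := by
    intro w hw
    rw [Matrix.ext_iff_trace_mul_right]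
    intro y
    obtain ⟨v, rfl⟩ := hx y
    have := htr (w * v)
    rw [wordDeriv_mul, hw, Matrix.zero_mul, add_zero] at this
    rw [this, Matrix.zero_mul, Matrix.trace_zero]
  obtain ⟨s, hs⟩ := (wordEval x).toLinearMap.exists_rightInverse_of_surjective
    (LinearMap.range_eq_top.2 hx)
  have hs' : ∀ y, wordEval x (s y) = y := fun y => LinearMap.congr_fun hs y
  have hD : ∀ w, (wordDeriv x X ∘ₗ s) (wordEval x w) = wordDeriv x X w := by
    intro w
    rw [LinearMap.comp_apply, ← sub_eq_zero, ← map_sub]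
    apply hker
    rw [map_sub, hs', sub_self]
  obtain ⟨ξ, hξ⟩ := exists_commutator_of_leibniz (wordDeriv x X ∘ₗ s) (by
    intro y z
    rw [← hs' y, ← hs' z, ← map_mul, hD, hD, hD, wordDeriv_mul])
  have key : ∀ A B : Matrix (Fin m) (Fin m) ℝ, A ∈ skewMatrices (Fin m) → B ∈ skewMatrices (Fin m) →
      B = ξ * A - A * ξ → B = (1 / 2 : ℝ) • (ξ - ξᵀ) * A - A * (1 / 2 : ℝ) • (ξ - ξᵀ) := by
    intro A B hA hB h
    rw [mem_skewMatrices] at hA hB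
    have h2 : B = -(ξᵀ * A - A * ξᵀ) := by
      have := congrArg Matrix.transpose h
      rw [Matrix.transpose_sub, Matrix.transpose_mul, Matrix.transpose_mul, hA, hB] at this
      rw [← neg_neg B, this]
      noncomm_ring
    have h3 : B = (1 / 2 : ℝ) • (B + B) := by module
    rw [h3]
    nth_rewrite 1 [h]
    rw [h2]
    simp only [Matrix.smul_mul, Matrix.mul_smul, sub_mul, mul_sub]
    module
  refine ⟨(1 / 2 : ℝ) • (ξ - ξᵀ), ?_, key _ _ (matAt_mem _ _) (matAt_mem _ _) ?_,
    key _ _ (matAt_mem _ _) (matAt_mem _ _) ?_⟩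
  · rw [mem_skewMatrices, Matrix.transpose_smul, Matrix.transpose_sub, Matrix.transpose_transpose]
    module
  · rw [← wordDeriv_ι_zero x X, ← hD, hξ]
    simp [wordEval]
  · rw [← wordDeriv_ι_one x X, ← hD, hξ]
    simp [wordEval]

end Invariants

section InvariantSpan

open Matrix

variable {m : ℕ}

theorem finrank_le_finrank_span_add_finrank {V : Type*} [NormedAddCommGroup V] [NormedSpace ℝ V]
    [FiniteDimensional ℝ V] (s : Set (V →L[ℝ] ℝ)) (K : Submodule ℝ V)
    (h : ∀ X, (∀ f ∈ s, f X = 0) → X ∈ K) :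
    Module.finrank ℝ V ≤ Module.finrank ℝ (Submodule.span ℝ s) + Module.finrank ℝ K := by
  let e : (V →L[ℝ] ℝ) ≃ₗ[ℝ] Module.Dual ℝ V := LinearMap.toContinuousLinearMap.symm
  have h1 := Subspace.finrank_add_finrank_dualCoannihilator_eq
    ((Submodule.span ℝ s).map e.toLinearMap)
  have h2 : Module.finrank ℝ ((Submodule.span ℝ s).map e.toLinearMap) =
      Module.finrank ℝ (Submodule.span ℝ s) := LinearEquiv.finrank_map_eq e _
  have h3 : ((Submodule.span ℝ s).map e.toLinearMap).dualCoannihilator ≤ K := by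
    intro X hX
    rw [Submodule.mem_dualCoannihilator] at hX
    exact h X fun f hf => hX _ ⟨f, Submodule.subset_span hf, rfl⟩
  have h4 := Submodule.finrank_mono h3
  omega

/-- The linear map `ξ ↦ ξ A - A ξ` on skew-symmetric matrices. -/
def commutatorWith {n : Type*} [Fintype n] (A : skewMatrices n) :
    skewMatrices n →ₗ[ℝ] skewMatrices n where
  toFun ξ := ⟨ξ.1 * A.1 - A.1 * ξ.1, commutator_mem_skewMatrices ξ.2 A.2⟩
  map_add' ξ η := by
    ext1
    simp only [Submodule.coe_add, add_mul, mul_add]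
    abel
  map_smul' c ξ := by
    ext1
    simp [smul_sub]

theorem ofPair_injective : Function.Injective (ofPair (m := m)) := by
  intro p q h
  have h0 := matAt_ofPair !₂[1, 0] p
  have h1 := matAt_ofPair !₂[0, 1] p
  rw [h, matAt_ofPair] at h0 h1
  simp only [Matrix.cons_val_zero, Matrix.cons_val_one, one_smul, zero_smul,
    add_zero, zero_add] at h0 h1
  exact Prod.ext (Subtype.ext h0.symm) (Subtype.ext h1.symm)

/-- A point of `Wso m` whose two matrices generate the full matrix algebra. -/
noncomputable def generatingPair (hm : 3 ≤ m) : Wso m :=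
  ofPair (⟨planeRotation (⟨0, by omega⟩ : Fin m) ⟨1, by omega⟩, planeRotation_mem _ _⟩,
    ⟨skewPath m, skewPath_mem m⟩)

theorem wordEval_generatingPair_surjective (hm : 3 ≤ m) :
    Function.Surjective (wordEval (generatingPair hm)) := by
  rw [← AlgHom.range_eq_top]
  refine subalgebra_eq_top_of_mem hm ⟨FreeAlgebra.ι ℝ 0, ?_⟩ ⟨FreeAlgebra.ι ℝ 1, ?_⟩ <;>
  simp [wordEval, generatingPair, matAt_ofPair]

theorem le_finrank_span_orthogonalInvariants (hm : 3 ≤ m) :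
    m * (m - 1) / 2 ≤ Module.finrank ℝ (Submodule.span ℝ
      ((fun f => fderiv ℝ f (generatingPair hm)) '' orthogonalInvariants m)) := by
  set x := generatingPair hm
  refine (le_finrank_skewMatrices m).trans ?_
  let ad : skewMatrices (Fin m) →ₗ[ℝ] Wso m :=
    ofPair ∘ₗ LinearMap.prod (commutatorWith ⟨matAt !₂[1, 0] x, matAt_mem _ _⟩)
      (commutatorWith ⟨matAt !₂[0, 1] x, matAt_mem _ _⟩)
  have h1 := finrank_le_finrank_span_add_finrank
    ((fun f => fderiv ℝ f x) '' orthogonalInvariants m) (LinearMap.range ad) fun X hX => by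
    obtain ⟨ξ, hξ, h0, h1⟩ := exists_skew_commutator (x := x) (X := X)
      (wordEval_generatingPair_surjective hm) (by omega) fun f hf => hX _ ⟨f, hf, rfl⟩
    refine ⟨⟨ξ, hξ⟩, eq_of_matAt_eq ?_ ?_⟩
    · rw [h0]
      simp [ad, matAt_ofPair, commutatorWith]
    · rw [h1]
      simp [ad, matAt_ofPair, commutatorWith]
  have h2 := LinearMap.finrank_range_le ad
  have h4 := LinearMap.finrank_le_finrank_of_injective (ofPair_injective (m := m))
  rw [Module.finrank_prod] at h4
  omega

end InvariantSpan

section CharpolySamples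

open Matrix Polynomial

variable {n : Type*} [Fintype n] [DecidableEq n]

theorem exists_polynomial_charpoly_coeff (A B : Matrix n n ℝ) {i r : ℕ}
    (h : i + r = Fintype.card n) :
    ∃ p : ℝ[X], p.natDegree ≤ r ∧ ∀ t : ℝ, (A + t • B).charpoly.coeff i = p.eval t := by
  let F := (Matrix.charpoly.univ ℝ n).coeff i
  let f : n × n → ℝ[X] := fun q => C (A q.1 q.2) + X * C (B q.1 q.2)
  refine ⟨MvPolynomial.aeval f F, ?_, fun t => ?_⟩
  · refine (MvPolynomial.aeval_natDegree_le (n := 1) F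
      (Matrix.charpoly.univ_coeff_isHomogeneous ℝ n i r h).totalDegree_le f fun q => ?_).trans
      (by omega)
    simp only [f]
    compute_degree
  · have h1 := Matrix.charpoly.univ_coeff_eval₂Hom n (RingHom.id ℝ)
      (fun q : n × n => (A + t • B) q.1 q.2) i
    have h2 : (Matrix.of (Function.curry fun q : n × n => (A + t • B) q.1 q.2)) = A + t • B := rfl
    rw [h2] at h1
    rw [← h1, MvPolynomial.coe_eval₂Hom, MvPolynomial.aeval_def, ← Polynomial.coe_evalRingHom,
      MvPolynomial.hom_eval₂]
    congr 1
    · ext; simp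
    · ext q
      simp only [f, coe_evalRingHom, eval_add, eval_mul, eval_X, eval_C]
      rfl

theorem charpoly_smul_coeff (A : Matrix n n ℝ) (c : ℝ) {i r : ℕ} (h : i + r = Fintype.card n) :
    (c • A).charpoly.coeff i = c ^ r * A.charpoly.coeff i := by
  have hF := Matrix.charpoly.univ_coeff_isHomogeneous ℝ n i r h
  have h1 := fun M : Matrix n n ℝ => Matrix.charpoly.univ_coeff_eval₂Hom n (RingHom.id ℝ)
      (fun q : n × n => M q.1 q.2) i
  have h2 := fun M : Matrix n n ℝ =>
    (show (Matrix.of (Function.curry fun q : n × n => M q.1 q.2)) = M from rfl)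
  simp only [h2] at h1
  rw [← h1, ← h1, MvPolynomial.coe_eval₂Hom, MvPolynomial.coe_eval₂Hom, MvPolynomial.eval₂_eq',
    MvPolynomial.eval₂_eq', Finset.mul_sum]
  refine Finset.sum_congr rfl fun d hd => ?_
  have hdeg : ∑ q, d q = r := by
    have := hF (MvPolynomial.mem_support_iff.1 hd)
    simpa [Finsupp.weight_apply, Finsupp.sum_fintype] using this
  simp only [Matrix.smul_apply, smul_eq_mul, mul_pow, Finset.prod_mul_distrib,
    Finset.prod_pow_eq_pow_sum, hdeg]
  ring

theorem charpoly_coeff_eq_zero_of_odd {A : Matrix n n ℝ} (hA : A ∈ skewMatrices n) {i r : ℕ}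
    (h : i + r = Fintype.card n) (hr : Odd r) : A.charpoly.coeff i = 0 := by
  have h1 := charpoly_smul_coeff A (-1) h
  rw [neg_one_smul, ← mem_skewMatrices.1 hA, Matrix.charpoly_transpose, hr.neg_one_pow] at h1
  linarith

theorem charpoly_add_smul_eq_of_samples {m : ℕ} {A B A' B' : Matrix (Fin m) (Fin m) ℝ}
    (hA : A ∈ skewMatrices (Fin m)) (hB : B ∈ skewMatrices (Fin m))
    (hA' : A' ∈ skewMatrices (Fin m)) (hB' : B' ∈ skewMatrices (Fin m))
    (h : ∀ i < m / 2, ∀ p < 2 * (i + 1) + 1, (A + (p : ℝ) • B).charpoly.coeff (m - 2 * (i + 1)) =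
      (A' + (p : ℝ) • B').charpoly.coeff (m - 2 * (i + 1))) (t : ℝ) :
    (A + t • B).charpoly = (A' + t • B').charpoly := by
  ext i
  have hdeg : ∀ M : Matrix (Fin m) (Fin m) ℝ, M.charpoly.natDegree = m := fun M => by
    rw [Matrix.charpoly_natDegree_eq_dim, Fintype.card_fin]
  rcases lt_trichotomy m i with hi | rfl | hi
  · rw [coeff_eq_zero_of_natDegree_lt (by rwa [hdeg]),
      coeff_eq_zero_of_natDegree_lt (by rwa [hdeg])]
  · have := fun M : Matrix (Fin m) (Fin m) ℝ => (hdeg M) ▸ (Matrix.charpoly_monic M).coeff_natDegree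
    rw [this, this]
  obtain ⟨r, rfl⟩ := Nat.exists_eq_add_of_lt hi
  have hc : i + (r + 1) = Fintype.card (Fin (i + r + 1)) := by rw [Fintype.card_fin]; ring
  rcases Nat.even_or_odd' (r + 1) with ⟨q, hq | hq⟩
  · obtain ⟨p, hp, hp'⟩ := exists_polynomial_charpoly_coeff A B hc
    obtain ⟨p', hpd, hpd'⟩ := exists_polynomial_charpoly_coeff A' B' hc
    have hs := h (q - 1) (by omega)
    rw [show i + r + 1 - 2 * (q - 1 + 1) = i by omega] at hs
    have : p = p' := by
      refine Polynomial.eq_of_degree_sub_lt_of_eval_finset_eq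
        ((Finset.range (r + 2)).image (fun k : ℕ => (k : ℝ))) ?_ ?_
      · rw [Finset.card_image_of_injective _ Nat.cast_injective, Finset.card_range]
        refine (Polynomial.degree_le_of_natDegree_le
          ((Polynomial.natDegree_sub_le _ _).trans (max_le hp hpd))).trans_lt ?_
        exact_mod_cast Nat.lt_succ_self _
      · intro x hx
        obtain ⟨k, hk, rfl⟩ := Finset.mem_image.1 hx
        rw [← hp', ← hpd']
        exact hs k (by have := Finset.mem_range.1 hk; omega)
    rw [hp', hpd', this]
  · rw [charpoly_coeff_eq_zero_of_odd (Submodule.add_mem _ hA (Submodule.smul_mem _ t hB)) hc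
      ⟨q, hq⟩,
      charpoly_coeff_eq_zero_of_odd (Submodule.add_mem _ hA' (Submodule.smul_mem _ t hB')) hc
        ⟨q, hq⟩]

theorem charpoly_smul_add_smul_eq_of_samples {m : ℕ} {A B A' B' : Matrix (Fin m) (Fin m) ℝ}
    (h : ∀ t : ℝ, (A + t • B).charpoly = (A' + t • B').charpoly) (a b : ℝ) :
    (a • A + b • B).charpoly = (a • A' + b • B').charpoly := by
  have hne : ∀ {a b : ℝ}, a ≠ 0 → (a • A + b • B).charpoly = (a • A' + b • B').charpoly := by
    intro a b ha
    have e : ∀ A B : Matrix (Fin m) (Fin m) ℝ, a • A + b • B = a • (A + (b / a) • B) := by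
      intro A B
      rw [smul_add, smul_smul, mul_div_cancel₀ _ ha]
    rw [e, e]
    exact charpoly_smul_eq_of_charpoly_eq (h _) ha
  by_cases ha : a = 0
  · subst ha
    ext i
    by_cases hi : i ≤ m
    · obtain ⟨r, hr⟩ := Nat.exists_eq_add_of_le hi
      have hc : i + r = Fintype.card (Fin m) := by rw [Fintype.card_fin, hr]
      obtain ⟨p, -, hp⟩ := exists_polynomial_charpoly_coeff (b • B) A hc
      obtain ⟨p', -, hp'⟩ := exists_polynomial_charpoly_coeff (b • B') A' hc
      have : p = p' := by
        refine Polynomial.eq_of_infinite_eval_eq _ _ ((Set.Ioi_infinite (0 : ℝ)).mono ?_)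
        intro t ht
        show p.eval t = p'.eval t
        rw [← hp, ← hp', add_comm, hne (ne_of_gt ht), add_comm]
      have h1 := hp 0
      have h2 := hp' 0
      rw [zero_smul, add_zero] at h1 h2
      rw [zero_smul, zero_add, zero_smul, zero_add, h1, h2, this]
    · rw [coeff_eq_zero_of_natDegree_lt, coeff_eq_zero_of_natDegree_lt] <;>
      rw [Matrix.charpoly_natDegree_eq_dim, Fintype.card_fin] <;> omega
  · exact hne ha

end CharpolySamples

section Isospectrality

open Matrix

variable {m : ℕ}

theorem isPolyFun_eval_matAt (Z : EuclideanSpace ℝ (Fin 2))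
    (p : MvPolynomial (Fin m × Fin m) ℝ) :
    IsPolyFun (fun j : Wso m =>
      MvPolynomial.eval₂Hom (RingHom.id ℝ) (fun q => matAt Z j q.1 q.2) p) := by
  induction p using MvPolynomial.induction_on with
  | C a =>
    simp only [MvPolynomial.coe_eval₂Hom, MvPolynomial.eval₂_C]
    exact IsPolyFun.const _
  | add p q hp hq =>
    simp only [map_add]
    exact hp.add hq
  | mul_X p q hp =>
    simp only [map_mul, MvPolynomial.eval₂Hom_X']
    exact hp.mul (isPolyFun_matAt Z q.1 q.2)

theorem isPolyFun_charpoly_coeff (Z : EuclideanSpace ℝ (Fin 2)) (i : ℕ) :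
    IsPolyFun (fun j : Wso m => (matAt Z j).charpoly.coeff i) := by
  have h := isPolyFun_eval_matAt (m := m) Z ((Matrix.charpoly.univ ℝ (Fin m)).coeff i)
  simp only [Matrix.charpoly.univ_coeff_eval₂Hom] at h
  exact h

/-- Finitely many coefficients of characteristic polynomials that determine the isospectrality
class of `j`. -/
noncomputable def charpolySample (m : ℕ) (q : Σ i : Fin (m / 2), Fin (2 * ((i : ℕ) + 1) + 1))
    (j : Wso m) : ℝ :=
  (matAt !₂[1, (q.2 : ℕ)] j).charpoly.coeff (m - 2 * ((q.1 : ℕ) + 1))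

theorem isPolyFun_charpolySample (q : Σ i : Fin (m / 2), Fin (2 * ((i : ℕ) + 1) + 1)) :
    IsPolyFun (charpolySample m q) :=
  isPolyFun_charpoly_coeff _ _

theorem card_charpolySample_index (m : ℕ) :
    Fintype.card (Σ i : Fin (m / 2), Fin (2 * ((i : ℕ) + 1) + 1)) = m / 2 * (m / 2 + 2) := by
  rw [Fintype.card_sigma]
  simp only [Fintype.card_fin]
  rw [Fin.sum_univ_eq_sum_range (fun i => 2 * (i + 1) + 1)]
  induction m / 2 with
  | zero => rfl
  | succ k ih =>
    rw [Finset.sum_range_succ, ih]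
    ring

theorem charpoly_eq_of_charpolySample_eq {j j' : Wso m}
    (h : ∀ q, charpolySample m q j = charpolySample m q j') (Z : EuclideanSpace ℝ (Fin 2)) :
    (matAt Z j).charpoly = (matAt Z j').charpoly := by
  rw [matAt_eq Z j, matAt_eq Z j']
  refine charpoly_smul_add_smul_eq_of_samples (charpoly_add_smul_eq_of_samples (matAt_mem _ _)
    (matAt_mem _ _) (matAt_mem _ _) (matAt_mem _ _) fun i hi p hp => ?_) _ _
  have := h ⟨⟨i, hi⟩, ⟨p, hp⟩⟩
  simp only [charpolySample] at this
  rw [matAt_eq, matAt_eq _ j'] at this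
  simpa using this

theorem exists_orthogonal_conj_of_charpolySample_eq {j j' : Wso m}
    (h : ∀ q, charpolySample m q j = charpolySample m q j') (Z : EuclideanSpace ℝ (Fin 2)) :
    ∃ O ∈ orthogonalGroup (Fin m) ℝ, O * matAt Z j = matAt Z j' * O :=
  exists_orthogonal_conj_of_charpoly_eq (mem_skewMatrices.1 (matAt_mem _ _))
    (mem_skewMatrices.1 (matAt_mem _ _)) (charpoly_eq_of_charpolySample_eq h Z)

theorem isospectralJ_of_charpolySample_eq {j j' : Wso m}
    (h : ∀ q, charpolySample m q j = charpolySample m q j') : IsospectralJ m j j' := fun Z => by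
  obtain ⟨O, hO, hO'⟩ := exists_orthogonal_conj_of_charpolySample_eq h Z
  exact exists_isometry_of_orthogonal hO hO'

end Isospectrality

section PlaneSymmetries

open Matrix

variable {m : ℕ}

/-- An orthogonal substitution preserving a binary quadratic form and a binary quartic form in
general position is `± 1`. -/
theorem eq_one_or_neg_one_of_preserves_forms {c s c' s' a b d r₀ r₁ r₂ r₃ r₄ : ℝ}
    (h₁ : c ^ 2 + s ^ 2 = 1) (h₂ : c' ^ 2 + s' ^ 2 = 1) (h₃ : c * c' + s * s' = 0)
    (hq : ∀ x y : ℝ, a * (x * c + y * c') ^ 2 + b * (x * c + y * c') * (x * s + y * s') +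
      d * (x * s + y * s') ^ 2 = a * x ^ 2 + b * x * y + d * y ^ 2)
    (hr : ∀ x y : ℝ, r₀ * (x * c + y * c') ^ 4 + r₁ * (x * c + y * c') ^ 3 * (x * s + y * s') +
      r₂ * (x * c + y * c') ^ 2 * (x * s + y * s') ^ 2 +
      r₃ * (x * c + y * c') * (x * s + y * s') ^ 3 + r₄ * (x * s + y * s') ^ 4 =
      r₀ * x ^ 4 + r₁ * x ^ 3 * y + r₂ * x ^ 2 * y ^ 2 + r₃ * x * y ^ 3 + r₄ * y ^ 4)
    (hw : (a - d) * (r₁ + r₃) - 2 * b * (r₀ - r₄) ≠ 0) :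
    (c = 1 ∧ s = 0 ∧ c' = 0 ∧ s' = 1) ∨ (c = -1 ∧ s = 0 ∧ c' = 0 ∧ s' = -1) := by
  obtain ⟨e, he, rfl, rfl⟩ : ∃ e : ℝ, e ^ 2 = 1 ∧ c' = -(e * s) ∧ s' = e * c := by
    refine ⟨c * s' - s * c', ?_, ?_, ?_⟩
    · linear_combination (c' ^ 2 + s' ^ 2) * h₁ + h₂ - (c * c' + s * s') * h₃
    · linear_combination (-c') * h₁ + c * h₃
    · linear_combination (-s') * h₁ + s * h₃
  have hs : s = 0 := by
    by_contra hs
    have q0 := hq 1 0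
    have r0 := hr 1 0
    have r1 := hr 0 1
    have hQ : -(s * (a - d)) + c * b = 0 := by
      refine (mul_eq_zero.1 ?_).resolve_left hs
      linear_combination q0 - a * h₁
    have hR : -(2 * s * (r₀ - r₄)) + c * (r₁ + r₃) = 0 := by
      refine (mul_eq_zero.1 ?_).resolve_left hs
      linear_combination r0 - r1 - ((c ^ 2 - s ^ 2 + 1) * (r₀ - r₄) + c * s * (r₁ + r₃)) * h₁ +
        (e ^ 2 + 1) * (r₀ * s ^ 4 - r₁ * s ^ 3 * c + r₂ * s ^ 2 * c ^ 2 - r₃ * s * c ^ 3 +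
          r₄ * c ^ 4) * he
    have e1 : s * ((a - d) * (r₁ + r₃) - 2 * b * (r₀ - r₄)) = 0 := by
      linear_combination b * hR - (r₁ + r₃) * hQ
    exact hw ((mul_eq_zero.1 e1).resolve_left hs)
  subst hs
  have q1 := hq 1 1
  have r1 := hr 1 1
  have hc : c ^ 2 = 1 := by linear_combination h₁
  rcases sq_eq_one_iff.1 he with rfl | rfl <;>
  rcases sq_eq_one_iff.1 hc with rfl | rfl <;> norm_num
  all_goals
    apply hw
    linear_combination (r₀ - r₄) * q1 - (a - d) / 2 * r1

theorem exists_trace_sq_form (A B : Matrix (Fin m) (Fin m) ℝ) : ∃ a b d : ℝ, ∀ x y : ℝ,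
    ((x • A + y • B) ^ 2).trace = a * x ^ 2 + b * x * y + d * y ^ 2 := by
  refine ⟨(A * A).trace, (A * B).trace + (B * A).trace, (B * B).trace, fun x y => ?_⟩
  simp only [pow_succ, pow_zero, Matrix.one_mul, Matrix.add_mul, Matrix.mul_add,
    Matrix.smul_mul, Matrix.mul_smul, Matrix.trace_add, Matrix.trace_smul, smul_eq_mul]
  ring

theorem exists_trace_pow_four_form (A B : Matrix (Fin m) (Fin m) ℝ) :
    ∃ r₀ r₁ r₂ r₃ r₄ : ℝ, ∀ x y : ℝ, ((x • A + y • B) ^ 4).trace =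
      r₀ * x ^ 4 + r₁ * x ^ 3 * y + r₂ * x ^ 2 * y ^ 2 + r₃ * x * y ^ 3 + r₄ * y ^ 4 := by
  let t : ∀ X Y Z W : Matrix (Fin m) (Fin m) ℝ, ℝ := fun X Y Z W => (X * Y * Z * W).trace
  refine ⟨t A A A A, t A A A B + t A A B A + t A B A A + t B A A A,
    t A A B B + t A B A B + t A B B A + t B A A B + t B A B A + t B B A A,
    t A B B B + t B A B B + t B B A B + t B B B A, t B B B B, fun x y => ?_⟩
  simp only [t, pow_succ, pow_zero, Matrix.one_mul, Matrix.add_mul, Matrix.mul_add,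
    Matrix.smul_mul, Matrix.mul_smul, Matrix.trace_add, Matrix.trace_smul, smul_eq_mul]
  ring

/-- The trace of a power of `j(Z)`. -/
noncomputable def tracePow (k : ℕ) (Z : EuclideanSpace ℝ (Fin 2)) (j : Wso m) : ℝ :=
  (matAt Z j ^ k).trace

theorem isPolyFun_tracePow (k : ℕ) (Z : EuclideanSpace ℝ (Fin 2)) :
    IsPolyFun (fun j : Wso m => tracePow k Z j) := by
  have h : ∀ a b, IsPolyFun (fun j : Wso m => (matAt Z j ^ k) a b) := by
    induction k with
    | zero =>
      intro a b
      simp only [pow_zero]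
      exact IsPolyFun.const _
    | succ k ih =>
      intro a b
      simp only [pow_succ, Matrix.mul_apply]
      exact IsPolyFun.sum _ fun c _ => (ih a c).mul (isPolyFun_matAt Z c b)
  exact IsPolyFun.sum Finset.univ fun a _ => h a a

/-- If this function does not vanish at `j`, then the only isometries of the plane preserving the
traces of `j(Z) ^ 2` and `j(Z) ^ 4` are `± 1`. -/
noncomputable def planeDiscriminant (j : Wso m) : ℝ :=
  (tracePow 2 !₂[1, 0] j - tracePow 2 !₂[0, 1] j) *
      (tracePow 4 !₂[1, 1] j - tracePow 4 !₂[1, -1] j) -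
    2 * ((tracePow 2 !₂[1, 1] j - tracePow 2 !₂[1, -1] j) *
      (tracePow 4 !₂[1, 0] j - tracePow 4 !₂[0, 1] j))

theorem isPolyFun_planeDiscriminant : IsPolyFun (planeDiscriminant (m := m)) :=
  (((isPolyFun_tracePow _ _).sub (isPolyFun_tracePow _ _)).mul
    ((isPolyFun_tracePow _ _).sub (isPolyFun_tracePow _ _))).sub
    ((IsPolyFun.const 2).mul (((isPolyFun_tracePow _ _).sub (isPolyFun_tracePow _ _)).mul
    ((isPolyFun_tracePow _ _).sub (isPolyFun_tracePow _ _))))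

theorem isometry_eq_id_or_neg {j : Wso m} (hj : planeDiscriminant j ≠ 0)
    (C : EuclideanSpace ℝ (Fin 2) ≃ₗᵢ[ℝ] EuclideanSpace ℝ (Fin 2))
    (hC : ∀ k Z, tracePow k (C Z) j = tracePow k Z j) :
    (∀ Z, C Z = Z) ∨ ∀ Z, C Z = -Z := by
  obtain ⟨a, b, d, hq⟩ := exists_trace_sq_form (matAt !₂[1, 0] j) (matAt !₂[0, 1] j)
  obtain ⟨r₀, r₁, r₂, r₃, r₄, hr⟩ := exists_trace_pow_four_form (matAt !₂[1, 0] j)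
    (matAt !₂[0, 1] j)
  have hq' : ∀ Z, tracePow 2 Z j = a * Z 0 ^ 2 + b * Z 0 * Z 1 + d * Z 1 ^ 2 := fun Z => by
    rw [tracePow, matAt_eq, hq]
  have hr' : ∀ Z, tracePow 4 Z j = r₀ * Z 0 ^ 4 + r₁ * Z 0 ^ 3 * Z 1 + r₂ * Z 0 ^ 2 * Z 1 ^ 2 +
      r₃ * Z 0 * Z 1 ^ 3 + r₄ * Z 1 ^ 4 := fun Z => by
    rw [tracePow, matAt_eq, hr]
  have hCZ : ∀ Z i, C Z i = Z 0 * C !₂[1, 0] i + Z 1 * C !₂[0, 1] i := by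
    intro Z i
    have h : Z = Z 0 • !₂[1, 0] + Z 1 • !₂[0, 1] := by
      ext i
      fin_cases i <;> simp
    conv_lhs => rw [h, map_add, map_smul, map_smul]
    rfl
  have hin : ∀ Z Z' : EuclideanSpace ℝ (Fin 2),
      C Z 0 * C Z' 0 + C Z 1 * C Z' 1 = Z 0 * Z' 0 + Z 1 * Z' 1 := by
    intro Z Z'
    have h := C.inner_map_map Z Z'
    simp only [PiLp.inner_apply, Fin.sum_univ_two, RCLike.inner_apply, conj_trivial] at h
    linarith
  have h := eq_one_or_neg_one_of_preserves_forms (c := C !₂[1, 0] 0) (s := C !₂[1, 0] 1)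
    (c' := C !₂[0, 1] 0) (s' := C !₂[0, 1] 1) (a := a) (b := b) (d := d) (r₀ := r₀) (r₁ := r₁)
    (r₂ := r₂) (r₃ := r₃) (r₄ := r₄) ?_ ?_ ?_ ?_ ?_ ?_
  · rcases h with ⟨h1, h2, h3, h4⟩ | ⟨h1, h2, h3, h4⟩
    · left
      intro Z
      ext i
      fin_cases i <;> simp [hCZ Z, h1, h2, h3, h4]
    · right
      intro Z
      ext i
      fin_cases i <;> simp [hCZ Z, h1, h2, h3, h4]
  · simpa [sq] using hin !₂[1, 0] !₂[1, 0]
  · simpa [sq] using hin !₂[0, 1] !₂[0, 1]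
  · simpa using hin !₂[1, 0] !₂[0, 1]
  · intro x y
    have h := hC 2 !₂[x, y]
    rw [hq', hq', hCZ _ 0, hCZ _ 1] at h
    simpa using h
  · intro x y
    have h := hC 4 !₂[x, y]
    rw [hr', hr', hCZ _ 0, hCZ _ 1] at h
    simpa using h
  · intro h
    apply hj
    simp only [planeDiscriminant, hq', hr']
    simp
    linear_combination 2 * h

theorem exists_planeDiscriminant_ne_zero (hm : 4 ≤ m) : ∃ j : Wso m, planeDiscriminant j ≠ 0 := by
  let E : Matrix (Fin m) (Fin m) ℝ := planeRotation ⟨0, by omega⟩ ⟨1, by omega⟩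
  let G : Matrix (Fin m) (Fin m) ℝ := planeRotation ⟨2, by omega⟩ ⟨3, by omega⟩
  have hEG : E * G = 0 := by
    simp [E, G, planeRotation, sub_mul, mul_sub]
  have hGE : G * E = 0 := by
    simp [E, G, planeRotation, sub_mul, mul_sub]
  have hE3 : E ^ 2 * E = -E := by
    simp [E, planeRotation, sub_mul, mul_sub, sq]
    abel
  have hG3 : G ^ 2 * G = -G := by
    simp [G, planeRotation, sub_mul, mul_sub, sq]
    abel
  have hE : (E ^ 2).trace = -2 := by
    simp [E, planeRotation, sub_mul, mul_sub, sq]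
    norm_num
  have hG : (G ^ 2).trace = -2 := by
    simp [G, planeRotation, sub_mul, mul_sub, sq]
    norm_num
  have h2 : ∀ x y : ℝ, (x • E + y • G) ^ 2 = x ^ 2 • E ^ 2 + y ^ 2 • G ^ 2 := by
    intro x y
    simp [sq, add_mul, mul_add, hEG, hGE, smul_smul]
  have h4 : ∀ x y : ℝ, (x • E + y • G) ^ 4 = -(x ^ 4 • E ^ 2) - y ^ 4 • G ^ 2 := by
    intro x y
    have e1 : E ^ 2 * G ^ 2 = 0 := by
      rw [sq G, ← Matrix.mul_assoc, sq E, Matrix.mul_assoc E, hEG]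
      simp
    have e2 : G ^ 2 * E ^ 2 = 0 := by
      rw [sq E, ← Matrix.mul_assoc, sq G, Matrix.mul_assoc G, hGE]
      simp
    have e3 : E ^ 2 * E ^ 2 = -E ^ 2 := by
      rw [sq E, ← Matrix.mul_assoc, ← sq E, hE3, Matrix.neg_mul, sq]
    have e4 : G ^ 2 * G ^ 2 = -G ^ 2 := by
      rw [sq G, ← Matrix.mul_assoc, ← sq G, hG3, Matrix.neg_mul, sq]
    rw [show 4 = 2 * 2 from rfl, pow_mul, h2, sq (_ + _)]
    simp only [Matrix.add_mul, Matrix.mul_add, Matrix.smul_mul, Matrix.mul_smul, e1, e2, e3, e4]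
    module
  have hEm : E ∈ skewMatrices (Fin m) := planeRotation_mem _ _
  have hGm : G ∈ skewMatrices (Fin m) := planeRotation_mem _ _
  have hM : ∀ Z : EuclideanSpace ℝ (Fin 2),
      matAt Z (ofPair (⟨E + G, Submodule.add_mem _ hEm hGm⟩, ⟨G, hGm⟩)) =
        Z 0 • E + (Z 0 + Z 1) • G := fun Z => by
    rw [matAt_ofPair]
    module
  have ht2 : ∀ Z, tracePow 2 Z (ofPair (⟨E + G, Submodule.add_mem _ hEm hGm⟩, ⟨G, hGm⟩)) =
      -2 * (Z 0 ^ 2 + (Z 0 + Z 1) ^ 2) := fun Z => by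
    rw [tracePow, hM, h2, Matrix.trace_add, Matrix.trace_smul, Matrix.trace_smul, hE, hG,
      smul_eq_mul, smul_eq_mul]
    ring
  have ht4 : ∀ Z, tracePow 4 Z (ofPair (⟨E + G, Submodule.add_mem _ hEm hGm⟩, ⟨G, hGm⟩)) =
      2 * (Z 0 ^ 4 + (Z 0 + Z 1) ^ 4) := fun Z => by
    rw [tracePow, hM, h4, Matrix.trace_sub, Matrix.trace_neg, Matrix.trace_smul, Matrix.trace_smul,
      hE, hG, smul_eq_mul, smul_eq_mul]
    ring
  refine ⟨ofPair (⟨E + G, Submodule.add_mem _ hEm hGm⟩, ⟨G, hGm⟩), ?_⟩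
  simp only [planeDiscriminant, ht2, ht4]
  simp
  norm_num

end PlaneSymmetries

section Equivalence

open Matrix
open scoped Topology

variable {m : ℕ}

theorem tracePow_eq_of_orthogonal {j j' : Wso m} {O : Matrix (Fin m) (Fin m) ℝ}
    (hO : O ∈ orthogonalGroup (Fin m) ℝ) {Z Z' : EuclideanSpace ℝ (Fin 2)}
    (h : O * matAt Z j = matAt Z' j' * O) (k : ℕ) : tracePow k Z j = tracePow k Z' j' :=
  trace_eq_of_orthogonal hO (SemiconjBy.pow_right (show SemiconjBy O _ _ from h) k)

theorem tracePow_eq_of_charpolySample_eq {j j' : Wso m}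
    (h : ∀ q, charpolySample m q j = charpolySample m q j') (k : ℕ)
    (Z : EuclideanSpace ℝ (Fin 2)) : tracePow k Z j = tracePow k Z j' := by
  obtain ⟨O, hO, hO'⟩ := exists_orthogonal_conj_of_charpolySample_eq h Z
  exact tracePow_eq_of_orthogonal hO hO' k

theorem exists_orthogonal_of_equivalentJ {j j' : Wso m} (hj : planeDiscriminant j ≠ 0)
    (h : ∀ q, charpolySample m q j = charpolySample m q j') (he : EquivalentJ m j j') :
    ∃ O ∈ orthogonalGroup (Fin m) ℝ, (∀ Z, O * matAt Z j = matAt Z j' * O) ∨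
      ∀ Z, O * matAt Z j = matAt Z (-j') * O := by
  obtain ⟨A, C, hAC⟩ := he
  obtain ⟨O, hO, hOA⟩ := exists_orthogonal_matrix A
  have hOC : ∀ Z, O * matAt Z j = matAt (C Z) j' * O := fun Z => hOA j j' Z (C Z) (hAC Z)
  refine ⟨O, hO, ?_⟩
  rcases isometry_eq_id_or_neg hj C fun k Z => by
    rw [tracePow_eq_of_charpolySample_eq h, tracePow_eq_of_orthogonal hO (hOC Z)] with hC | hC
  · exact .inl fun Z => by rw [hOC, hC]
  · exact .inr fun Z => by rw [hOC, hC, matAt_neg, map_neg]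

/-- Generically, conjugacy of `x` with `-y`, for `x` and `y` close to each other, forces `x` and `y`
to have the same orthogonal invariants. -/
theorem exists_polyFun_forall_neg_conj (m : ℕ) :
    ∃ τ : Wso m → ℝ, IsPolyFun τ ∧ (∃ j, τ j ≠ 0) ∧ ∀ j, τ j ≠ 0 → ∃ U ∈ 𝓝 j,
      ∀ x ∈ U, ∀ y ∈ U, ∀ O ∈ orthogonalGroup (Fin m) ℝ,
        (∀ Z, O * matAt Z x = matAt Z (-y) * O) → ∀ f ∈ orthogonalInvariants m, f x = f y := by
  by_cases heven : ∀ f ∈ orthogonalInvariants m, ∀ j, f (-j) = f j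
  · exact ⟨fun _ => 1, IsPolyFun.const 1, ⟨0, one_ne_zero⟩, fun j _ => ⟨Set.univ, Filter.univ_mem,
      fun x _ y _ O hO h f hf => (hf.2 x (-y) O hO h).trans (heven f hf y)⟩⟩
  · push Not at heven
    obtain ⟨f, hf, j₀, hj₀⟩ := heven
    have hτ : IsPolyFun fun j : Wso m => f j - f (-j) :=
      hf.1.sub (hf.1.comp_linear (-LinearMap.id))
    refine ⟨_, hτ, ⟨j₀, sub_ne_zero.2 (Ne.symm hj₀)⟩, fun j hj =>
      ⟨{x | 0 < (f x - f (-x)) * (f j - f (-j))}, ?_, fun x hx y hy O hO h => ?_⟩⟩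
    · have hc : Continuous fun x => (f x - f (-x)) * (f j - f (-j)) :=
        hτ.differentiable.continuous.mul continuous_const
      exact (isOpen_lt continuous_const hc).mem_nhds (mul_self_pos.2 hj)
    · exfalso
      have h1 := hf.2 x (-y) O hO h
      have h2 := hf.2 (-x) y O hO fun Z => by
        have := h Z
        rw [map_neg, Matrix.neg_mul] at this
        rw [map_neg, Matrix.mul_neg, this, neg_neg]
      simp only [Set.mem_ofPred_eq] at hx hy
      rw [h1, h2] at hx
      linarith

theorem dimension_inequalities (hm : 0 < m) (hm' : m ∉ ({1, 2, 3, 4, 6} : Set ℕ)) :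
    4 ≤ m ∧ 1 < m * (m - 1) / 2 - (m / 2) * (m / 2 + 2) := by
  simp only [Set.mem_insert_iff, Set.mem_singleton_iff, not_or] at hm'
  refine ⟨by omega, ?_⟩
  rcases Nat.even_or_odd' m with ⟨k, rfl | rfl⟩
  · obtain ⟨n, rfl⟩ := Nat.exists_eq_add_of_le (show 4 ≤ k by omega)
    rw [show 2 * (4 + n) * (2 * (4 + n) - 1) = 2 * ((4 + n) * (2 * n + 7)) by
      rw [show 2 * (4 + n) - 1 = 2 * n + 7 by omega]; ring, Nat.mul_div_cancel_left _ two_pos,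
      Nat.mul_div_cancel_left _ two_pos, Nat.lt_sub_iff_add_lt]
    nlinarith
  · obtain ⟨n, rfl⟩ := Nat.exists_eq_add_of_le (show 2 ≤ k by omega)
    rw [show (2 * (2 + n) + 1) * (2 * (2 + n) + 1 - 1) = 2 * ((2 + n) * (2 * n + 5)) by
      rw [Nat.add_sub_cancel]; ring, Nat.mul_div_cancel_left _ two_pos,
      show (2 * (2 + n) + 1) / 2 = 2 + n by omega, Nat.lt_sub_iff_add_lt]
    nlinarith

end Equivalence

/-- For `m ∉ {1,2,3,4,6}`, with `d = m(m−1)/2 − ⌊m/2⌋(⌊m/2⌋+2) > 1`,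
there is a nonzero polynomial function `P` on `W_m` such that every `j` with `P(j) ≠ 0`
lies in a continuous injective `d`-parameter family (parametrized by the open unit ball
of `ℝ^d`) of pairwise isospectral, pairwise inequivalent elements of `W_m` through `j`. -/
theorem stmt12 (m : ℕ) (hm : 0 < m) (hm' : m ∉ ({1, 2, 3, 4, 6} : Set ℕ)) :
    1 < m * (m - 1) / 2 - (m / 2) * (m / 2 + 2) ∧
    ∃ P : Wso m → ℝ, IsPolynomialFun m P ∧ P ≠ 0 ∧
      ∀ j : Wso m, P j ≠ 0 →
        ∃ F : (Metric.ball (0 : EuclideanSpace ℝ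
            (Fin (m * (m - 1) / 2 - (m / 2) * (m / 2 + 2)))) 1) → Wso m,
          Continuous F ∧ Function.Injective F ∧
          F ⟨0, by simp⟩ = j ∧
          (∀ t s, IsospectralJ m (F t) (F s)) ∧
          (∀ t s, t ≠ s → ¬ EquivalentJ m (F t) (F s)) := by
  obtain ⟨hm4, hd⟩ := dimension_inequalities hm hm'
  refine ⟨hd, ?_⟩
  obtain ⟨P, hP, hP0, hPF⟩ := exists_generic_level_family
    (d := m * (m - 1) / 2 - (m / 2) * (m / 2 + 2)) isPolyFun_charpolySample
    (T := orthogonalInvariants m) (fun f hf => hf.1) (generatingPair (by omega)) (by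
      refine le_trans ?_ (le_finrank_span_orthogonalInvariants (by omega))
      rw [card_charpolySample_index]
      omega)
  obtain ⟨τ, hτ, hτ0, hτU⟩ := exists_polyFun_forall_neg_conj m
  have hw0 := IsPolyFun.exists_mul_ne_zero isPolyFun_planeDiscriminant hτ
    (exists_planeDiscriminant_ne_zero hm4) hτ0
  obtain ⟨x, hx⟩ := hP.exists_mul_ne_zero (isPolyFun_planeDiscriminant.mul hτ) hP0 hw0
  refine ⟨fun j => P j * (planeDiscriminant j * τ j), hP.mul (isPolyFun_planeDiscriminant.mul hτ),
    fun h => hx (congrFun h x), fun j hj => ?_⟩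
  obtain ⟨hPj, hwτ⟩ := mul_ne_zero_iff.1 hj
  obtain ⟨hwj, hτj⟩ := mul_ne_zero_iff.1 hwτ
  obtain ⟨U, hU, hUneg⟩ := hτU j hτj
  obtain ⟨F, hFc, hF0, hFU, hFΦ, hFsep⟩ := hPF j hPj U hU
  have hΦ : ∀ t s q, charpolySample m q (F t) = charpolySample m q (F s) := fun t s q =>
    (hFΦ q t).trans (hFΦ q s).symm
  refine ⟨F, hFc, fun t s hts => ?_, hF0, fun t s => isospectralJ_of_charpolySample_eq (hΦ t s),
    fun t s hts he => ?_⟩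
  · by_contra hne
    obtain ⟨f, -, hf⟩ := hFsep t s hne
    exact hf (by rw [hts])
  · have hw : planeDiscriminant (F t) ≠ 0 := by
      have h := fun k Z => tracePow_eq_of_charpolySample_eq (fun q => hFΦ q t) k Z
      simpa only [planeDiscriminant, h] using hwj
    obtain ⟨f, hf, hne⟩ := hFsep t s hts
    obtain ⟨O, hO, h | h⟩ := exists_orthogonal_of_equivalentJ hw (hΦ t s) he
    · exact hne (hf.2 _ _ O hO h)
    · exact hne (hUneg _ (hFU t) _ (hFU s) O hO h f hf)
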